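/- arXiv:2204.07016 — 8 statements merged into one kernel-verified Lean document; each statement's English description precedes it below -/
import Mathlib

section
/- B > 0, ψ''(B) = 0, ψ''(x) < 0 for every x ∈ [0, B), and ψ''(x) > 0 for every x > B; in particular, ψ is concave on [0, B] and convex on [B, ∞), and B is the unique zero of ψ''. -/
theorem hasDerivAt_exp_const_mul (k y : ℝ) :
    HasDerivAt (fun y => Real.exp (k * y)) (k * Real.exp (k * y)) y := by
  simpa [mul_comm] using ((hasDerivAt_id y).const_mul k).exp

theorem deriv_deriv_exp_sub_exp_div (a b c y : ℝ) :
    deriv (deriv fun y => (Real.exp (b * y) - Real.exp (a * y)) / c) y =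
      (b ^ 2 * Real.exp (b * y) - a ^ 2 * Real.exp (a * y)) / c := by
  have h := hasDerivAt_exp_const_mul
  have h' : deriv (fun y => (Real.exp (b * y) - Real.exp (a * y)) / c) =
      fun y => (b * Real.exp (b * y) - a * Real.exp (a * y)) / c :=
    funext fun y => (((h b y).sub (h a y)).div_const c).deriv
  rw [h', sq, sq, mul_assoc, mul_assoc]
  exact ((((h b y).const_mul b).sub ((h a y).const_mul a)).div_const c).deriv

theorem sq_mul_exp_lt_sq_mul_exp_iff {s t u v : ℝ} (hs : s ≠ 0) (ht : t ≠ 0) :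
    s ^ 2 * Real.exp u < t ^ 2 * Real.exp v ↔ Real.log (s ^ 2) + u < Real.log (t ^ 2) + v := by
  rw [← Real.exp_lt_exp (x := Real.log _ + u), Real.exp_add, Real.exp_add, Real.exp_log (by positivity),
    Real.exp_log (by positivity)]

/-- `B > 0`, `ψ''(B) = 0`, `ψ'' < 0` on `[0, B)` and `ψ'' > 0` on `(B, ∞)`;
in particular `ψ` is concave on `[0, B]`, convex on `[B, ∞)`, and `B` is the unique
(nonnegative) zero of `ψ''`. -/
theorem deFinetti_psi_inflection
    (μ σ r : ℝ) (hμ : 0 < μ) (hσ : 0 < σ) (hr : 0 < r)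
    (ζ₁ ζ₂ : ℝ)
    (hζ₁ : ζ₁ = (-μ - Real.sqrt (μ ^ 2 + 2 * r * σ ^ 2)) / σ ^ 2)
    (hζ₂ : ζ₂ = (-μ + Real.sqrt (μ ^ 2 + 2 * r * σ ^ 2)) / σ ^ 2)
    (ψ : ℝ → ℝ)
    (hψ : ∀ y : ℝ, ψ y = (Real.exp (ζ₂ * y) - Real.exp (ζ₁ * y)) / (ζ₂ - ζ₁))
    (B : ℝ) (hB : B = (Real.log (ζ₁ ^ 2) - Real.log (ζ₂ ^ 2)) / (ζ₂ - ζ₁)) :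
    0 < B ∧
      deriv (deriv ψ) B = 0 ∧
      (∀ y : ℝ, 0 ≤ y → y < B → deriv (deriv ψ) y < 0) ∧
      (∀ y : ℝ, B < y → 0 < deriv (deriv ψ) y) ∧
      ConcaveOn ℝ (Set.Icc 0 B) ψ ∧
      ConvexOn ℝ (Set.Ici B) ψ ∧
      (∀ y : ℝ, 0 ≤ y → (deriv (deriv ψ) y = 0 ↔ y = B)) := by
  have hσ2 : 0 < σ ^ 2 := by positivity
  have hsqrt : μ < Real.sqrt (μ ^ 2 + 2 * r * σ ^ 2) :=
    Real.lt_sqrt_of_sq_lt (lt_add_of_pos_right _ (by positivity))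
  have h₁ : ζ₁ < 0 := hζ₁ ▸ div_neg_of_neg_of_pos (by linarith) hσ2
  have h₂ : 0 < ζ₂ := hζ₂ ▸ div_pos (by linarith) hσ2
  have hsum : ζ₁ + ζ₂ < 0 := by
    rw [hζ₁, hζ₂, ← add_div]
    exact div_neg_of_neg_of_pos (by linarith) hσ2
  have hd : 0 < ζ₂ - ζ₁ := by linarith
  have hBd : B * (ζ₂ - ζ₁) = Real.log (ζ₁ ^ 2) - Real.log (ζ₂ ^ 2) := by
    rw [hB, div_mul_cancel₀ _ hd.ne']
  obtain rfl : ψ = fun y => (Real.exp (ζ₂ * y) - Real.exp (ζ₁ * y)) / (ζ₂ - ζ₁) := funext hψ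
  set ψ : ℝ → ℝ := fun y => (Real.exp (ζ₂ * y) - Real.exp (ζ₁ * y)) / (ζ₂ - ζ₁)
  have hψ'' (y : ℝ) : deriv (deriv ψ) y =
      (ζ₂ ^ 2 * Real.exp (ζ₂ * y) - ζ₁ ^ 2 * Real.exp (ζ₁ * y)) / (ζ₂ - ζ₁) :=
    deriv_deriv_exp_sub_exp_div ..
  have hneg (y : ℝ) : deriv (deriv ψ) y < 0 ↔ y < B := by
    rw [hψ'', div_lt_iff₀ hd, zero_mul, sub_neg, sq_mul_exp_lt_sq_mul_exp_iff h₂.ne' h₁.ne,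
      ← mul_lt_mul_iff_left₀ (b := y) (c := B) hd, hBd]
    constructor <;> intro h <;> linarith
  have hpos (y : ℝ) : 0 < deriv (deriv ψ) y ↔ B < y := by
    rw [hψ'', lt_div_iff₀ hd, zero_mul, sub_pos, sq_mul_exp_lt_sq_mul_exp_iff h₁.ne h₂.ne',
      ← mul_lt_mul_iff_left₀ (b := B) (c := y) hd, hBd]
    constructor <;> intro h <;> linarith
  have hzero (y : ℝ) : deriv (deriv ψ) y = 0 ↔ y = B := by
    rw [eq_iff_le_not_lt, eq_iff_le_not_lt, hneg, ← not_lt, hpos, not_lt]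
  have hcont : Continuous ψ := by fun_prop
  refine ⟨?_, (hzero B).2 rfl, fun y _ => (hneg y).2, fun y => (hpos y).2, ?_, ?_,
    fun y _ => hzero y⟩
  · rw [hB]
    exact div_pos (sub_pos.2 (Real.log_lt_log (by positivity) (by nlinarith))) hd
  · refine (strictConcaveOn_of_deriv2_neg (convex_Icc 0 B) hcont.continuousOn
      fun y hy => ?_).concaveOn
    rw [interior_Icc] at hy
    exact (hneg y).2 hy.2
  · refine (strictConvexOn_of_deriv2_pos (convex_Ici B) hcont.continuousOn
      fun y hy => ?_).convexOn
    rw [interior_Ici] at hy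
    exact (hpos y).2 hy
end

section
/- The function V is continuously differentiable on [0,∞) with V(0) = 0 and V'(x) = ψ'(x)/ψ'(B) for x ∈ [0,B] (so in particular V'(B) = 1, matching the derivative of x − B + V(B)); V is concave on [0,∞); V' is strictly decreasing on [0,B]; V'(x) = 1 for all x ≥ B; and V'(x) ≥ 1 for all x ≥ 0. -/
/-- A function equal to `f / f' B` left of `B`, extended right of `B` by its tangent line at `B`,
is differentiable everywhere, with derivative `f' (min y B) / f' B`. -/
theorem hasDerivAt_of_tangent_extension {f f' V : ℝ → ℝ} {B : ℝ}
    (hf : ∀ y, HasDerivAt f (f' y) y) (hB : f' B ≠ 0)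
    (hV₁ : ∀ y, y ≤ B → V y = f y / f' B) (hV₂ : ∀ y, B < y → V y = y - B + V B) (y : ℝ) :
    HasDerivAt V (f' (min y B) / f' B) y := by
  rcases lt_trichotomy y B with h | rfl | h
  · rw [min_eq_left h.le]
    refine ((hf y).div_const _).congr_of_eventuallyEq ?_
    filter_upwards [Iio_mem_nhds h] with x hx using hV₁ x (le_of_lt hx)
  · rw [min_self]
    have hl : HasDerivWithinAt V (f' y / f' y) (Set.Iic y) y :=
      ((hf y).div_const _).hasDerivWithinAt.congr (fun x hx => hV₁ x hx) (hV₁ y le_rfl)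
    have hr : HasDerivWithinAt V (f' y / f' y) (Set.Ici y) y := by
      rw [div_self hB]
      refine (((hasDerivAt_id y).sub_const y).add_const (V y)).hasDerivWithinAt.congr
        (fun x hx => ?_) (by simp)
      rcases (Set.mem_Ici.1 hx).eq_or_lt with rfl | hx
      · simp
      · simpa using hV₂ x hx
    simpa [Set.Iic_union_Ici, hasDerivWithinAt_univ] using hl.union hr
  · rw [min_eq_right h.le, div_self hB]
    refine (((hasDerivAt_id y).sub_const B).add_const (V B)).congr_of_eventuallyEq ?_
    filter_upwards [Ioi_mem_nhds h] with x hx using hV₂ x hx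

/-- The derivative `b e^{by} - a e^{ay}` of `e^{by} - e^{ay}` decreases strictly up to
`(log a² - log b²) / (b - a)`. -/
theorem strictAntiOn_mul_exp_sub_mul_exp {a b : ℝ} (ha : a ≠ 0) (hb : b ≠ 0) (hab : a < b) :
    StrictAntiOn (fun y => b * Real.exp (b * y) - a * Real.exp (a * y))
      (Set.Iic ((Real.log (a ^ 2) - Real.log (b ^ 2)) / (b - a))) := by
  refine strictAntiOn_of_deriv_neg (convex_Iic _) (by fun_prop) fun y hy => ?_
  rw [interior_Iic, Set.mem_Iio, lt_div_iff₀ (sub_pos.2 hab)] at hy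
  have hexp (c : ℝ) : HasDerivAt (fun y => c * Real.exp (c * y)) (c ^ 2 * Real.exp (c * y)) y := by
    refine ((hasDerivAt_id y).const_mul c).exp.const_mul c |>.congr_deriv ?_
    simp only [id, mul_one]
    ring
  rw [((hexp b).fun_sub (hexp a)).deriv, sub_neg, ← Real.exp_log (sq_pos_iff.2 hb),
    ← Real.exp_log (sq_pos_iff.2 ha), ← Real.exp_add, ← Real.exp_add]
  exact Real.exp_lt_exp.2 (by linarith)


/-- The single-player value function `V` is `C¹` on `[0, ∞)` with `V(0) = 0`,
`V'(x) = ψ'(x)/ψ'(B)` on `[0, B]` (so `V'(B) = 1`), `V` is concave on `[0, ∞)`,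
`V'` is strictly decreasing on `[0, B]`, `V'(x) = 1` for `x ≥ B`, and `V' ≥ 1` on `[0, ∞)`.
(Here `V` is given by `ψ(x)/ψ'(B)` for `x ≤ B` and by `x − B + V(B)` for `x > B`.) -/
theorem deFinetti_value_function_properties
    (μ σ r : ℝ) (hμ : 0 < μ) (hσ : 0 < σ) (hr : 0 < r)
    (ζ₁ ζ₂ : ℝ)
    (hζ₁ : ζ₁ = (-μ - Real.sqrt (μ ^ 2 + 2 * r * σ ^ 2)) / σ ^ 2)
    (hζ₂ : ζ₂ = (-μ + Real.sqrt (μ ^ 2 + 2 * r * σ ^ 2)) / σ ^ 2)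
    (ψ : ℝ → ℝ)
    (hψ : ∀ y : ℝ, ψ y = (Real.exp (ζ₂ * y) - Real.exp (ζ₁ * y)) / (ζ₂ - ζ₁))
    (B : ℝ) (hB : B = (Real.log (ζ₁ ^ 2) - Real.log (ζ₂ ^ 2)) / (ζ₂ - ζ₁))
    (V : ℝ → ℝ)
    (hV₁ : ∀ y : ℝ, y ≤ B → V y = ψ y / deriv ψ B)
    (hV₂ : ∀ y : ℝ, B < y → V y = y - B + V B) :
    ContDiffOn ℝ 1 V (Set.Ici (0 : ℝ)) ∧
      V 0 = 0 ∧
      (∀ y : ℝ, 0 ≤ y → y ≤ B → deriv V y = deriv ψ y / deriv ψ B) ∧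
      deriv V B = 1 ∧
      ConcaveOn ℝ (Set.Ici (0 : ℝ)) V ∧
      StrictAntiOn (deriv V) (Set.Icc 0 B) ∧
      (∀ y : ℝ, B ≤ y → deriv V y = 1) ∧
      (∀ y : ℝ, 0 ≤ y → 1 ≤ deriv V y) := by
  have hsq : μ < Real.sqrt (μ ^ 2 + 2 * r * σ ^ 2) :=
    Real.lt_sqrt_of_sq_lt (lt_add_of_pos_right _ (by positivity))
  have h₁ : ζ₁ < 0 := hζ₁ ▸ div_neg_of_neg_of_pos (by linarith) (by positivity)
  have h₂ : 0 < ζ₂ := hζ₂ ▸ div_pos (by linarith) (by positivity)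
  have hd : 0 < ζ₂ - ζ₁ := by linarith
  have habs : ζ₂ < -ζ₁ := by
    rw [hζ₁, hζ₂, ← neg_div]
    exact div_lt_div_of_pos_right (by linarith) (by positivity)
  have hB₀ : 0 < B := by
    rw [hB]
    exact div_pos (sub_pos.2 (Real.log_lt_log (by positivity) (by nlinarith))) hd
  set D : ℝ → ℝ := fun y =>
    (ζ₂ * Real.exp (ζ₂ * y) - ζ₁ * Real.exp (ζ₁ * y)) / (ζ₂ - ζ₁) with hD
  have hDψ (y : ℝ) : HasDerivAt ψ (D y) y := by
    rw [funext hψ]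
    have hexp (c : ℝ) : HasDerivAt (fun y => Real.exp (c * y)) (c * Real.exp (c * y)) y := by
      simpa [mul_comm] using ((hasDerivAt_id y).const_mul c).exp
    exact ((hexp ζ₂).sub (hexp ζ₁)).div_const _
  have hDpos (y : ℝ) : 0 < D y :=
    div_pos (sub_pos.2 ((mul_neg_of_neg_of_pos h₁ (Real.exp_pos _)).trans
      (mul_pos h₂ (Real.exp_pos _)))) hd
  have hDanti : StrictAntiOn D (Set.Iic B) := by
    intro x hx y hy hxy
    rw [hB] at hx hy
    exact div_lt_div_of_pos_right
      (strictAntiOn_mul_exp_sub_mul_exp h₁.ne h₂.ne' (sub_pos.1 hd) hx hy hxy) hd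
  rw [(hDψ B).deriv] at hV₁ ⊢
  have hV (y : ℝ) : HasDerivAt V (D (min y B) / D B) y :=
    hasDerivAt_of_tangent_extension hDψ (hDpos B).ne' hV₁ hV₂ y
  have hV' (y : ℝ) : deriv V y = D (min y B) / D B := (hV y).deriv
  have hVdiff : Differentiable ℝ V := fun y => (hV y).differentiableAt
  have hone : ∀ y, B ≤ y → deriv V y = 1 := fun y hy => by
    rw [hV', min_eq_right hy, div_self (hDpos B).ne']
  have hanti : Antitone (deriv V) := fun x y hxy => by
    rw [hV', hV']
    exact div_le_div_of_nonneg_right (hDanti.antitoneOn (Set.mem_Iic.2 (min_le_right _ _))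
      (Set.mem_Iic.2 (min_le_right _ _)) (min_le_min_right _ hxy)) (hDpos B).le
  refine ⟨?_, ?_, ?_, hone B le_rfl, ?_, ?_, hone, ?_⟩
  · refine (contDiff_one_iff_deriv.2 ⟨hVdiff, ?_⟩).contDiffOn
    rw [funext hV']
    fun_prop
  · simp [hV₁ 0 hB₀.le, hψ]
  · intro y _ hy
    rw [hV', (hDψ y).deriv, min_eq_left hy]
  · exact (hanti.concaveOn_univ_of_deriv hVdiff).subset (Set.subset_univ _) (convex_Ici 0)
  · intro x hx y hy hxy
    rw [hV', hV', min_eq_left hx.2, min_eq_left hy.2]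
    exact div_lt_div_of_pos_right (hDanti hx.2 hy.2 hxy) (hDpos B)
  · intro y _
    rw [← hone (max y B) (le_max_right _ _)]
    exact hanti (le_max_left _ _)
end

section
/- The function c restricted to [0,B] is a continuous, strictly decreasing bijection from [0,B] onto [0, p̂], with c(0) = p̂ ∈ (0,1) and c(B) = 0; moreover c is differentiable on (0,B) with c'(x) < 0 for x ∈ (0,B), and c'(x) → 0 as x → B from the left. -/
open Set Filter Topology in
/-- If `g` is positive with a continuous derivative that is negative left of `B` and zero at `B`,
then a function agreeing with `1 - g B / g` on `[0, B]` is a decreasing bijection of `[0, B]` onto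
`[0, c 0]` that is flat at `B`. -/
theorem properties_of_eqOn_one_sub_div {g g' c : ℝ → ℝ} {B : ℝ} (hB : 0 < B)
    (hg : ∀ y, HasDerivAt g (g' y) y) (hpos : ∀ y, 0 < g y) (hcont : Continuous g')
    (hneg : ∀ y, y < B → g' y < 0) (hzero : g' B = 0)
    (hc : EqOn c (fun y => 1 - g B / g y) (Icc 0 B)) :
    ContinuousOn c (Icc 0 B) ∧ StrictAntiOn c (Icc 0 B) ∧ BijOn c (Icc 0 B) (Icc 0 (c 0)) ∧
      c 0 ∈ Ioo (0 : ℝ) 1 ∧ c B = 0 ∧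
      (∀ y ∈ Ioo (0 : ℝ) B, DifferentiableAt ℝ c y ∧ deriv c y < 0) ∧
      Tendsto (deriv c) (𝓝[<] B) (𝓝 0) := by
  have hf (y : ℝ) : HasDerivAt (fun y => 1 - g B / g y) (g B * g' y / g y ^ 2) y := by
    have h := ((hasDerivAt_const y (g B)).div (hg y) (hpos y).ne').const_sub 1
    refine h.congr_deriv ?_
    ring
  have hgc : Continuous g := continuous_iff_continuousAt.2 fun y => (hg y).continuousAt
  have hcd (y : ℝ) (hy : y ∈ Ioo 0 B) : HasDerivAt c (g B * g' y / g y ^ 2) y :=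
    (hf y).congr_of_eventuallyEq <|
      hc.eventuallyEq_of_mem (Icc_mem_nhds hy.1 hy.2)
  have hcdneg (y : ℝ) (hy : y < B) : g B * g' y / g y ^ 2 < 0 :=
    div_neg_of_neg_of_pos (mul_neg_of_pos_of_neg (hpos B) (hneg y hy)) (pow_pos (hpos y) 2)
  have hc_cont : ContinuousOn c (Icc 0 B) :=
    ContinuousOn.congr (fun y _ => (hf y).continuousAt.continuousWithinAt) hc
  have hc_anti : StrictAntiOn c (Icc 0 B) := by
    refine strictAntiOn_of_deriv_neg (convex_Icc 0 B) hc_cont fun y hy => ?_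
    rw [interior_Icc] at hy
    rw [(hcd y hy).deriv]
    exact hcdneg y hy.2
  have h0 : (0 : ℝ) ∈ Icc 0 B := left_mem_Icc.2 hB.le
  have h1 : B ∈ Icc 0 B := right_mem_Icc.2 hB.le
  have hcB : c B = 0 := by
    rw [hc h1]
    simp [(hpos B).ne']
  refine ⟨hc_cont, hc_anti, ⟨fun y hy => ⟨?_, ?_⟩, hc_anti.injOn, ?_⟩, ⟨?_, ?_⟩, hcB,
    fun y hy => ⟨(hcd y hy).differentiableAt, ?_⟩, ?_⟩
  · rw [← hcB]
    exact hc_anti.antitoneOn hy h1 hy.2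
  · exact hc_anti.antitoneOn h0 hy hy.1
  · have h := intermediate_value_Icc' hB.le hc_cont
    rwa [hcB] at h
  · exact hcB.symm.trans_lt (hc_anti h0 h1 hB)
  · rw [hc h0]
    exact sub_lt_self 1 (div_pos (hpos B) (hpos 0))
  · rw [(hcd y hy).deriv]
    exact hcdneg y hy.2
  · have hlim : Tendsto (fun y => g B * g' y / g y ^ 2) (𝓝[<] B) (𝓝 0) := by
      have h : Continuous fun y => g B * g' y / g y ^ 2 :=
        (continuous_const.mul hcont).div (hgc.pow 2) fun y => (pow_pos (hpos y) 2).ne'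
      have h' := h.tendsto B
      rw [hzero, mul_zero, zero_div] at h'
      exact h'.mono_left nhdsWithin_le_nhds
    refine hlim.congr' ?_
    filter_upwards [Ioo_mem_nhdsLT hB] with y hy
    exact (hcd y hy).deriv.symm

/-- A function that agrees with `f` up to `B` and is affine of slope `f' B` right of `B` is differentiable
at `B`. -/
theorem HasDerivAt.of_left_eq_of_right_affine {f V : ℝ → ℝ} {B m : ℝ} (hf : HasDerivAt f m B)
    (hl : ∀ y ≤ B, V y = f y) (hr : ∀ y, B < y → V y = m * (y - B) + V B) :
    HasDerivAt V m B := by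
  rw [← hasDerivWithinAt_univ, ← Set.Iic_union_Ici (a := B)]
  refine HasDerivWithinAt.union (hf.hasDerivWithinAt.congr hl (hl B le_rfl)) ?_
  have h : HasDerivAt (fun y => m * (y - B) + V B) m B := by
    simpa using (((hasDerivAt_id B).sub_const B).const_mul m).add_const (V B)
  refine h.hasDerivWithinAt.congr (fun y hy => ?_) (by simp)
  rcases (Set.mem_Ici.1 hy).eq_or_lt with rfl | hy
  · simp
  · exact hr y hy

open Real in
/-- `b² exp (b y)` is below `a² exp (a y)` left of `(log a² - log b²) / (b - a)`. -/
theorem sq_mul_exp_lt_sq_mul_exp {a b y : ℝ} (ha : a ≠ 0) (hb : b ≠ 0) (hab : a < b)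
    (hy : y < (log (a ^ 2) - log (b ^ 2)) / (b - a)) :
    b ^ 2 * exp (b * y) < a ^ 2 * exp (a * y) := by
  rw [lt_div_iff₀ (sub_pos.2 hab)] at hy
  calc b ^ 2 * exp (b * y) = exp (log (b ^ 2) + b * y) := by
        rw [exp_add, exp_log (by positivity)]
    _ < exp (log (a ^ 2) + a * y) := exp_lt_exp.2 (by linarith)
    _ = a ^ 2 * exp (a * y) := by rw [exp_add, exp_log (by positivity)]

open Real in
/-- `b² exp (b y)` and `a² exp (a y)` agree at `(log a² - log b²) / (b - a)`. -/
theorem sq_mul_exp_eq_sq_mul_exp {a b y : ℝ} (ha : a ≠ 0) (hb : b ≠ 0) (hab : a < b)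
    (hy : y = (log (a ^ 2) - log (b ^ 2)) / (b - a)) :
    b ^ 2 * exp (b * y) = a ^ 2 * exp (a * y) := by
  rw [eq_div_iff (sub_pos.2 hab).ne'] at hy
  calc b ^ 2 * exp (b * y) = exp (log (b ^ 2) + b * y) := by
        rw [exp_add, exp_log (by positivity)]
    _ = exp (log (a ^ 2) + a * y) := congrArg exp (by linarith)
    _ = a ^ 2 * exp (a * y) := by rw [exp_add, exp_log (by positivity)]

/-- The boundary function `c(x) = (V'(x) − 1)/V'(x)` restricted to `[0, B]`
is a continuous strictly decreasing bijection onto `[0, p̂]`, with `c(0) = p̂ ∈ (0,1)` and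
`c(B) = 0`; `c` is differentiable on `(0, B)` with `c' < 0` there, and `c'(x) → 0` as `x → B⁻`. -/
theorem deFinetti_boundary_c_properties
    (μ σ r : ℝ) (hμ : 0 < μ) (hσ : 0 < σ) (hr : 0 < r)
    (ζ₁ ζ₂ : ℝ)
    (hζ₁ : ζ₁ = (-μ - Real.sqrt (μ ^ 2 + 2 * r * σ ^ 2)) / σ ^ 2)
    (hζ₂ : ζ₂ = (-μ + Real.sqrt (μ ^ 2 + 2 * r * σ ^ 2)) / σ ^ 2)
    (ψ : ℝ → ℝ)
    (hψ : ∀ y : ℝ, ψ y = (Real.exp (ζ₂ * y) - Real.exp (ζ₁ * y)) / (ζ₂ - ζ₁))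
    (B : ℝ) (hB : B = (Real.log (ζ₁ ^ 2) - Real.log (ζ₂ ^ 2)) / (ζ₂ - ζ₁))
    (V : ℝ → ℝ)
    (hV₁ : ∀ y : ℝ, y ≤ B → V y = ψ y / deriv ψ B)
    (hV₂ : ∀ y : ℝ, B < y → V y = y - B + V B)
    (c : ℝ → ℝ)
    (hc₁ : ∀ y : ℝ, 0 ≤ y → y ≤ B → c y = (deriv V y - 1) / deriv V y)
    (hc₂ : ∀ y : ℝ, B < y → c y = 0)
    (phat : ℝ) (hphat : phat = (deriv V 0 - 1) / deriv V 0) :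
    ContinuousOn c (Set.Icc 0 B) ∧
      StrictAntiOn c (Set.Icc 0 B) ∧
      Set.BijOn c (Set.Icc 0 B) (Set.Icc 0 phat) ∧
      c 0 = phat ∧ phat ∈ Set.Ioo (0 : ℝ) 1 ∧ c B = 0 ∧
      (∀ y ∈ Set.Ioo (0 : ℝ) B, DifferentiableAt ℝ c y ∧ deriv c y < 0) ∧
      Filter.Tendsto (deriv c) (nhdsWithin B (Set.Iio B)) (nhds 0) := by
  have hσ2 : 0 < σ ^ 2 := pow_pos hσ 2
  have hs : μ < √(μ ^ 2 + 2 * r * σ ^ 2) :=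
    Real.lt_sqrt_of_sq_lt (by nlinarith [mul_pos hr hσ2])
  have ha : ζ₁ < 0 := hζ₁ ▸ div_neg_of_neg_of_pos (by linarith) hσ2
  have hb : 0 < ζ₂ := hζ₂ ▸ div_pos (by linarith) hσ2
  have hba : ζ₂ < -ζ₁ := by
    rw [hζ₁, hζ₂, ← neg_div]
    exact div_lt_div_of_pos_right (by linarith) hσ2
  have hd : 0 < ζ₂ - ζ₁ := by linarith
  have hBpos : 0 < B := by
    rw [hB]
    refine div_pos (sub_pos.2 (Real.log_lt_log (pow_pos hb 2) ?_)) hd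
    nlinarith
  obtain ⟨g, hg⟩ : ∃ g : ℝ → ℝ, g = fun y =>
      (ζ₂ * Real.exp (ζ₂ * y) - ζ₁ * Real.exp (ζ₁ * y)) / (ζ₂ - ζ₁) := ⟨_, rfl⟩
  have hexp (k y : ℝ) : HasDerivAt (fun y => Real.exp (k * y)) (k * Real.exp (k * y)) y := by
    simpa [mul_comm] using ((hasDerivAt_id y).const_mul k).exp
  have hψg (y : ℝ) : HasDerivAt ψ (g y) y := by
    rw [funext hψ, hg]
    exact ((hexp ζ₂ y).sub (hexp ζ₁ y)).div_const _
  have hg' (y : ℝ) : HasDerivAt g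
      ((ζ₂ ^ 2 * Real.exp (ζ₂ * y) - ζ₁ ^ 2 * Real.exp (ζ₁ * y)) / (ζ₂ - ζ₁)) y := by
    rw [hg]
    refine ((((hexp ζ₂ y).const_mul ζ₂).sub ((hexp ζ₁ y).const_mul ζ₁)).div_const _).congr_deriv ?_
    ring
  have hgpos (y : ℝ) : 0 < g y := by
    rw [hg]
    refine div_pos ?_ hd
    linarith [mul_pos hb (Real.exp_pos (ζ₂ * y)), mul_neg_of_neg_of_pos ha (Real.exp_pos (ζ₁ * y))]
  have hV (y : ℝ) (hy : y ≤ B) : HasDerivAt V (g y / g B) y := by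
    have h := (hψg y).div_const (g B)
    rw [(hψg B).deriv] at hV₁
    rcases hy.eq_or_lt with rfl | hy
    · refine h.of_left_eq_of_right_affine hV₁ fun z hz => ?_
      rw [div_self (hgpos y).ne', one_mul, hV₂ z hz]
    · refine h.congr_of_eventuallyEq ?_
      filter_upwards [Iic_mem_nhds hy] with z hz using hV₁ z hz
  have hc : Set.EqOn c (fun y => 1 - g B / g y) (Set.Icc 0 B) := by
    intro y hy
    have h₁ := (hgpos y).ne'
    have h₂ := (hgpos B).ne'
    rw [hc₁ y hy.1 hy.2, (hV y hy.2).deriv]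
    field_simp
  have hc0 : c 0 = phat := by rw [hphat, hc₁ 0 le_rfl hBpos.le]
  obtain ⟨h₁, h₂, h₃, h₄, h₅, h₆, h₇⟩ := properties_of_eqOn_one_sub_div hBpos hg' hgpos
    (by fun_prop)
    (fun y hy => div_neg_of_neg_of_pos (sub_neg.2 <|
      sq_mul_exp_lt_sq_mul_exp ha.ne hb.ne' (by linarith) (hB ▸ hy)) hd)
    (by rw [sq_mul_exp_eq_sq_mul_exp ha.ne hb.ne' (by linarith) hB, sub_self, zero_div]) hc
  rw [hc0] at h₃ h₄
  exact ⟨h₁, h₂, h₃, hc0, h₄, h₅, h₆, h₇⟩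
end

section
/- For every x ∈ (0,B] one has ψ(x) ≥ x ψ'(x), i.e. λ(x) = ψ(x)/(xψ'(x)) − 1 ≥ 0; moreover λ(x) → 0 as x → 0⁺, so λ extends to a bounded continuous function on [0,B] with value 0 at x = 0. -/
/-- If `f 0 = 0` and the derivative of `f` is antitone on `[0, B]`, then `y f'(y) ≤ f y` there. -/
lemma mul_deriv_le_of_antitoneOn {f f' : ℝ → ℝ} {B : ℝ} (hf : ∀ y, HasDerivAt f (f' y) y)
    (hf0 : f 0 = 0) (hanti : AntitoneOn f' (Set.Icc 0 B)) {y : ℝ} (hy : 0 < y) (hyB : y ≤ B) :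
    y * f' y ≤ f y := by
  obtain ⟨c, ⟨hc0, hcy⟩, hc⟩ := exists_hasDerivAt_eq_slope f f' hy
    (fun z _ => (hf z).continuousAt.continuousWithinAt) (fun z _ => hf z)
  rw [hf0, sub_zero, sub_zero, eq_div_iff hy.ne'] at hc
  have hle : f' y ≤ f' c := hanti ⟨hc0.le, hcy.le.trans hyB⟩ ⟨hy.le, hyB⟩ hcy.le
  nlinarith

lemma hasDerivAt_exp_mul (b y : ℝ) :
    HasDerivAt (fun y => Real.exp (b * y)) (b * Real.exp (b * y)) y := by
  simpa [mul_comm] using ((hasDerivAt_id y).const_mul b).exp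

/-- The derivative of `exp (b y) - exp (a y)` is antitone up to its inflection point. -/
lemma antitoneOn_deriv_exp_sub_exp {a b : ℝ} (ha : a < 0) (hb : 0 < b) :
    AntitoneOn (fun y => b * Real.exp (b * y) - a * Real.exp (a * y))
      (Set.Icc 0 ((Real.log (a ^ 2) - Real.log (b ^ 2)) / (b - a))) := by
  have hderiv : ∀ y, HasDerivAt (fun y => b * Real.exp (b * y) - a * Real.exp (a * y))
      (b * (b * Real.exp (b * y)) - a * (a * Real.exp (a * y))) y := fun y =>
    ((hasDerivAt_exp_mul b y).const_mul b).sub ((hasDerivAt_exp_mul a y).const_mul a)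
  refine antitoneOn_of_deriv_nonpos (convex_Icc _ _)
    (fun y _ => (hderiv y).continuousAt.continuousWithinAt)
    (fun y _ => (hderiv y).differentiableAt.differentiableWithinAt) fun y hy => ?_
  rw [interior_Icc] at hy
  have hy2 := hy.2
  rw [lt_div_iff₀ (by linarith)] at hy2
  have hexp : Real.exp (Real.log (b ^ 2) + b * y) ≤ Real.exp (Real.log (a ^ 2) + a * y) :=
    Real.exp_le_exp.2 (by linarith)
  rw [Real.exp_add, Real.exp_add, Real.exp_log (by positivity),
    Real.exp_log (sq_pos_of_neg ha)] at hexp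
  rw [(hderiv y).deriv]
  linarith


/-- For every `x ∈ (0, B]` one has `ψ(x) ≥ x ψ'(x)`, i.e.
`λ(x) = ψ(x)/(x ψ'(x)) − 1 ≥ 0`; moreover `λ(x) → 0` as `x → 0⁺`, so `λ` extends to a
bounded continuous function on `[0, B]` with value `0` at `x = 0`. -/
theorem deFinetti_lambda_nonneg_and_extension
    (μ σ r : ℝ) (hμ : 0 < μ) (hσ : 0 < σ) (hr : 0 < r)
    (ζ₁ ζ₂ : ℝ)
    (hζ₁ : ζ₁ = (-μ - Real.sqrt (μ ^ 2 + 2 * r * σ ^ 2)) / σ ^ 2)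
    (hζ₂ : ζ₂ = (-μ + Real.sqrt (μ ^ 2 + 2 * r * σ ^ 2)) / σ ^ 2)
    (ψ : ℝ → ℝ)
    (hψ : ∀ y : ℝ, ψ y = (Real.exp (ζ₂ * y) - Real.exp (ζ₁ * y)) / (ζ₂ - ζ₁))
    (B : ℝ) (hB : B = (Real.log (ζ₁ ^ 2) - Real.log (ζ₂ ^ 2)) / (ζ₂ - ζ₁))
    (lam : ℝ → ℝ)
    (hlam : ∀ y : ℝ, 0 < y → y ≤ B → lam y = ψ y / (y * deriv ψ y) - 1) :
    (∀ y : ℝ, 0 < y → y ≤ B → y * deriv ψ y ≤ ψ y ∧ 0 ≤ lam y) ∧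
      Filter.Tendsto lam (nhdsWithin 0 (Set.Ioi 0)) (nhds 0) ∧
      (∃ lamExt : ℝ → ℝ,
        ContinuousOn lamExt (Set.Icc 0 B) ∧
        lamExt 0 = 0 ∧
        (∀ y : ℝ, 0 < y → y ≤ B → lamExt y = lam y) ∧
        ∃ M : ℝ, ∀ y ∈ Set.Icc (0 : ℝ) B, |lamExt y| ≤ M) := by
  have hS : μ < Real.sqrt (μ ^ 2 + 2 * r * σ ^ 2) :=
    Real.lt_sqrt_of_sq_lt (by nlinarith [mul_pos hr (pow_pos hσ 2)])
  have hσ2 : 0 < σ ^ 2 := pow_pos hσ 2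
  have ha : ζ₁ < 0 := hζ₁ ▸ div_neg_of_neg_of_pos (by linarith) hσ2
  have hb : 0 < ζ₂ := hζ₂ ▸ div_pos (by linarith) hσ2
  have hba : ζ₂ < -ζ₁ := by
    rw [hζ₁, hζ₂, ← neg_div]
    exact div_lt_div_of_pos_right (by linarith) hσ2
  have hd : 0 < ζ₂ - ζ₁ := by linarith
  have hBpos : 0 < B := by
    rw [hB]
    exact div_pos (sub_pos.2 (Real.log_lt_log (pow_pos hb 2) (by nlinarith))) hd
  set ψ' : ℝ → ℝ := fun y => (ζ₂ * Real.exp (ζ₂ * y) - ζ₁ * Real.exp (ζ₁ * y)) / (ζ₂ - ζ₁)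
    with hψ'
  have hderiv : ∀ y, HasDerivAt ψ (ψ' y) y := fun y => by
    rw [funext hψ]
    exact ((hasDerivAt_exp_mul ζ₂ y).sub (hasDerivAt_exp_mul ζ₁ y)).div_const _
  have hψ'pos : ∀ y, 0 < ψ' y := fun y =>
    div_pos (sub_pos.2 ((mul_neg_of_neg_of_pos ha (Real.exp_pos _)).trans
      (mul_pos hb (Real.exp_pos _)))) hd
  have hψ0 : ψ 0 = 0 := by simp [hψ]
  have hψ'0 : ψ' 0 = 1 := by simp [hψ', hd.ne']
  have hanti : AntitoneOn ψ' (Set.Icc 0 B) := fun x hx y hy hxy =>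
    div_le_div_of_nonneg_right
      (antitoneOn_deriv_exp_sub_exp ha hb (hB ▸ hx) (hB ▸ hy) hxy) hd.le
  set φ : ℝ → ℝ := fun y => dslope ψ 0 y / ψ' y - 1 with hφ
  have hcont : Continuous φ := by
    have hslope : Continuous (dslope ψ 0) := by
      rw [← continuousOn_univ, continuousOn_dslope Filter.univ_mem]
      exact ⟨fun y _ => (hderiv y).continuousAt.continuousWithinAt, (hderiv 0).differentiableAt⟩
    have hcont' : Continuous ψ' := by fun_prop
    exact (hslope.div hcont' fun y => (hψ'pos y).ne').sub continuous_const
  have hφ0 : φ 0 = 0 := by simp [hφ, (hderiv 0).deriv, hψ'0]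
  have hφlam : ∀ y, 0 < y → y ≤ B → φ y = lam y := fun y hy hyB => by
    rw [hlam y hy hyB, (hderiv y).deriv]
    simp only [hφ, dslope_of_ne _ hy.ne', slope_def_field, hψ0, sub_zero, div_div]
  refine ⟨fun y hy hyB => ?_, ?_, φ, hcont.continuousOn, hφ0, hφlam, ?_⟩
  · have hle := mul_deriv_le_of_antitoneOn hderiv hψ0 hanti hy hyB
    rw [hlam y hy hyB, (hderiv y).deriv]
    exact ⟨hle, sub_nonneg.2 ((one_le_div (mul_pos hy (hψ'pos y))).2 hle)⟩
  · have hlim : Filter.Tendsto φ (nhdsWithin 0 (Set.Ioi 0)) (nhds 0) := by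
      simpa only [hφ0] using (hcont.tendsto 0).mono_left nhdsWithin_le_nhds
    refine hlim.congr' ?_
    filter_upwards [Ioc_mem_nhdsGT hBpos] with y hy using hφlam y hy.1 hy.2
  · exact isCompact_Icc.exists_bound_of_continuousOn hcont.continuousOn
end

section
/- For each p ∈ [0,1], the function Λ is nondecreasing and continuous on [b(p), B], the map x ↦ Λ(x) + x is a strictly increasing continuous bijection from [b(p), B] onto [b(p), Λ(B) + B], and consequently the function f is well defined, nondecreasing and continuous on [b(p), ∞), with f(b(p)) = b(p) and f(y) = B for every y ≥ Λ(B) + B. -/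
/-- `y ↦ (exp (v y) - exp (u y)) / (v - u)` has derivative
`(v exp (v y) - u exp (u y)) / (v - u)`. -/
theorem hasDerivAt_exp_sub_exp_div (u v y : ℝ) :
    HasDerivAt (fun y : ℝ => (Real.exp (v * y) - Real.exp (u * y)) / (v - u))
      ((v * Real.exp (v * y) - u * Real.exp (u * y)) / (v - u)) y := by
  have h (a : ℝ) : HasDerivAt (fun y : ℝ => Real.exp (a * y)) (a * Real.exp (a * y)) y := by
    simpa [mul_comm] using ((hasDerivAt_id y).const_mul a).exp
  exact ((h v).sub (h u)).div_const _

/-- The derivative of `y ↦ (v exp (v y) - u exp (u y)) / (v - u)`. -/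
theorem hasDerivAt_mul_exp_sub_mul_exp_div (u v y : ℝ) :
    HasDerivAt (fun y : ℝ => (v * Real.exp (v * y) - u * Real.exp (u * y)) / (v - u))
      ((v ^ 2 * Real.exp (v * y) - u ^ 2 * Real.exp (u * y)) / (v - u)) y := by
  have h (a : ℝ) :
      HasDerivAt (fun y : ℝ => a * Real.exp (a * y)) (a ^ 2 * Real.exp (a * y)) y := by
    simpa [pow_two, mul_assoc, mul_comm, mul_left_comm] using
      (((hasDerivAt_id y).const_mul a).exp).const_mul a
  exact ((h v).sub (h u)).div_const _

/-- For `u < 0 < v`, `y ↦ (v exp (v y) - u exp (u y)) / (v - u)` is nonincreasing up to the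
point where its derivative vanishes. -/
theorem antitoneOn_mul_exp_sub_mul_exp_div {u v : ℝ} (hu : u < 0) (hv : 0 < v) :
    AntitoneOn (fun y : ℝ => (v * Real.exp (v * y) - u * Real.exp (u * y)) / (v - u))
      (Set.Iic ((Real.log (u ^ 2) - Real.log (v ^ 2)) / (v - u))) := by
  have huv : 0 < v - u := by linarith
  refine antitoneOn_of_hasDerivWithinAt_nonpos (convex_Iic _)
    (fun y _ => (hasDerivAt_mul_exp_sub_mul_exp_div u v y).continuousAt.continuousWithinAt)
    (fun y _ => (hasDerivAt_mul_exp_sub_mul_exp_div u v y).hasDerivWithinAt) ?_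
  intro y hy
  rw [interior_Iic, Set.mem_Iio, lt_div_iff₀ huv] at hy
  refine div_nonpos_of_nonpos_of_nonneg (sub_nonpos.2 ?_) huv.le
  rw [← Real.exp_log (by positivity : 0 < v ^ 2), ← Real.exp_log (sq_pos_of_neg hu),
    ← Real.exp_add, ← Real.exp_add, Real.exp_le_exp]
  linarith

/-- If `L` is nondecreasing and continuous on `[a, B]` with `L a = 0`, then `z ↦ L z + z` is a
strictly increasing continuous bijection from `[a, B]` onto `[a, L B + B]`. -/
theorem bijOn_add_id_of_monotoneOn {L : ℝ → ℝ} {a B : ℝ} (hab : a ≤ B)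
    (hm : MonotoneOn L (Set.Icc a B)) (hc : ContinuousOn L (Set.Icc a B)) (ha : L a = 0) :
    StrictMonoOn (fun z => L z + z) (Set.Icc a B) ∧
      ContinuousOn (fun z => L z + z) (Set.Icc a B) ∧
      Set.BijOn (fun z => L z + z) (Set.Icc a B) (Set.Icc a (L B + B)) := by
  have hs : StrictMonoOn (fun z => L z + z) (Set.Icc a B) :=
    hm.add_strictMono strictMonoOn_id
  have hcont : ContinuousOn (fun z => L z + z) (Set.Icc a B) := hc.add continuousOn_id
  refine ⟨hs, hcont, ?_, hs.injOn, ?_⟩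
  · intro z hz
    have h₁ := hs.monotoneOn (Set.left_mem_Icc.2 hab) hz hz.1
    have h₂ := hs.monotoneOn hz (Set.right_mem_Icc.2 hab) hz.2
    simp only [ha, zero_add] at h₁
    exact ⟨h₁, h₂⟩
  · simpa [Set.SurjOn, ha] using intermediate_value_Icc hab hcont

/-- A function `f` inverting `z ↦ L z + z` up to truncation at `M`, with `L` nondecreasing, is
nondecreasing and `1`-Lipschitz. -/
theorem monotoneOn_and_lipschitzOnWith_of_add_eq_min {L f : ℝ → ℝ} {s t : Set ℝ} {M : ℝ}
    (hm : MonotoneOn L s) (hf : ∀ y ∈ t, f y ∈ s ∧ L (f y) + f y = min y M) :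
    MonotoneOn f t ∧ LipschitzOnWith 1 f t := by
  have hmono : MonotoneOn f t := by
    intro x hx y hy hxy
    by_contra! h
    have h₁ := hm (hf y hy).1 (hf x hx).1 h.le
    have h₂ := min_le_min_right M hxy
    linarith [(hf x hx).2, (hf y hy).2]
  refine ⟨hmono, LipschitzOnWith.of_le_add ?_⟩
  intro x hx y hy
  rcases le_total x y with hxy | hxy
  · linarith [hmono hx hy hxy, dist_nonneg (x := x) (y := y)]
  · have h₁ := hm (hf y hy).1 (hf x hx).1 (hmono hy hx hxy)
    have h₂ : min x M ≤ min y M + (x - y) := by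
      rw [← min_add_add_right]
      exact le_min ((min_le_left _ _).trans (by linarith))
        ((min_le_right _ _).trans (by linarith))
    have h₃ := le_abs_self (x - y)
    rw [Real.dist_eq]
    linarith [(hf x hx).2, (hf y hy).2]


/-- For each `p ∈ [0,1]`: `Λ` is nondecreasing and continuous on `[b(p), B]`,
`x ↦ Λ(x) + x` is a strictly increasing continuous bijection from `[b(p), B]` onto
`[b(p), Λ(B) + B]`, and hence `f` is well defined (unique solution of `Λ(f(y)) + f(y) = y`),
nondecreasing and continuous on `[b(p), ∞)`, with `f(b(p)) = b(p)` and `f(y) = B` for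
`y ≥ Λ(B) + B`. -/
theorem deFinetti_Lambda_f_properties
    (μ σ r : ℝ) (hμ : 0 < μ) (hσ : 0 < σ) (hr : 0 < r)
    (ζ₁ ζ₂ : ℝ)
    (hζ₁ : ζ₁ = (-μ - Real.sqrt (μ ^ 2 + 2 * r * σ ^ 2)) / σ ^ 2)
    (hζ₂ : ζ₂ = (-μ + Real.sqrt (μ ^ 2 + 2 * r * σ ^ 2)) / σ ^ 2)
    (ψ : ℝ → ℝ)
    (hψ : ∀ y : ℝ, ψ y = (Real.exp (ζ₂ * y) - Real.exp (ζ₁ * y)) / (ζ₂ - ζ₁))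
    (B : ℝ) (hB : B = (Real.log (ζ₁ ^ 2) - Real.log (ζ₂ ^ 2)) / (ζ₂ - ζ₁))
    (V : ℝ → ℝ)
    (hV₁ : ∀ y : ℝ, y ≤ B → V y = ψ y / deriv ψ B)
    (hV₂ : ∀ y : ℝ, B < y → V y = y - B + V B)
    (c : ℝ → ℝ)
    (hc₁ : ∀ y : ℝ, 0 ≤ y → y ≤ B → c y = (deriv V y - 1) / deriv V y)
    (hc₂ : ∀ y : ℝ, B < y → c y = 0)
    (phat : ℝ) (hphat : phat = (deriv V 0 - 1) / deriv V 0)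
    (b : ℝ → ℝ)
    (hb₁ : ∀ q : ℝ, 0 ≤ q → q ≤ phat → b q ∈ Set.Icc 0 B ∧ c (b q) = q)
    (hb₂ : ∀ q : ℝ, phat < q → q ≤ 1 → b q = 0)
    (lam : ℝ → ℝ)
    (hlam : ∀ y : ℝ, 0 < y → y ≤ B → lam y = ψ y / (y * deriv ψ y) - 1)
    (p : ℝ) (hp : p ∈ Set.Icc (0 : ℝ) 1)
    (Lam : ℝ → ℝ)
    (hLam : ∀ y : ℝ, b p ≤ y → y ≤ B → Lam y = ∫ z in (b p)..y, lam z)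
    (f : ℝ → ℝ)
    (hf₁ : ∀ y : ℝ, b p ≤ y → y ≤ Lam B + B →
      f y ∈ Set.Icc (b p) B ∧ Lam (f y) + f y = y)
    (hf₂ : ∀ y : ℝ, Lam B + B < y → f y = B) :
    MonotoneOn Lam (Set.Icc (b p) B) ∧
      ContinuousOn Lam (Set.Icc (b p) B) ∧
      StrictMonoOn (fun z => Lam z + z) (Set.Icc (b p) B) ∧
      ContinuousOn (fun z => Lam z + z) (Set.Icc (b p) B) ∧
      Set.BijOn (fun z => Lam z + z) (Set.Icc (b p) B) (Set.Icc (b p) (Lam B + B)) ∧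
      (∀ y ∈ Set.Icc (b p) (Lam B + B), ∃! z : ℝ, z ∈ Set.Icc (b p) B ∧ Lam z + z = y) ∧
      MonotoneOn f (Set.Ici (b p)) ∧
      ContinuousOn f (Set.Ici (b p)) ∧
      f (b p) = b p ∧
      (∀ y : ℝ, Lam B + B ≤ y → f y = B) := by
  have hσ2 : 0 < σ ^ 2 := by positivity
  have hsqrt : μ < Real.sqrt (μ ^ 2 + 2 * r * σ ^ 2) :=
    Real.lt_sqrt_of_sq_lt (by nlinarith [mul_pos hr hσ2])
  have hu : ζ₁ < 0 := by
    rw [hζ₁]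
    exact div_neg_of_neg_of_pos (by linarith) hσ2
  have hv : 0 < ζ₂ := by
    rw [hζ₂]
    exact div_pos (by linarith) hσ2
  have huv : ζ₂ < -ζ₁ := by
    rw [hζ₁, hζ₂, ← neg_div, div_lt_div_iff_of_pos_right hσ2]
    linarith
  have hB0 : 0 ≤ B := by
    rw [hB]
    refine div_nonneg (sub_nonneg.2 (Real.log_le_log (by positivity) ?_)) (by linarith)
    nlinarith
  have hbp : b p ∈ Set.Icc 0 B := by
    rcases le_or_gt p phat with h | h
    · exact (hb₁ p hp.1 h).1
    · rw [hb₂ p h hp.2]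
      exact ⟨le_rfl, hB0⟩
  have hψd (y : ℝ) : HasDerivAt ψ
      ((ζ₂ * Real.exp (ζ₂ * y) - ζ₁ * Real.exp (ζ₁ * y)) / (ζ₂ - ζ₁)) y := by
    rw [funext hψ]
    exact hasDerivAt_exp_sub_exp_div ζ₁ ζ₂ y
  have hψ' : deriv ψ =
      fun y => (ζ₂ * Real.exp (ζ₂ * y) - ζ₁ * Real.exp (ζ₁ * y)) / (ζ₂ - ζ₁) :=
    funext fun y => (hψd y).deriv
  have hψ'pos (y : ℝ) : 0 < deriv ψ y := by
    rw [hψ']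
    exact div_pos (sub_pos.2 ((mul_neg_of_neg_of_pos hu (Real.exp_pos _)).trans
      (mul_pos hv (Real.exp_pos _)))) (by linarith)
  have hψ'c : Continuous (deriv ψ) := by
    rw [hψ']
    fun_prop
  have hψ'anti : AntitoneOn (deriv ψ) (Set.Iic B) := by
    rw [hψ', hB]
    exact antitoneOn_mul_exp_sub_mul_exp_div hu hv
  have hψ0 : ψ 0 = 0 := by simp [hψ]
  have hψc : Continuous ψ := continuous_iff_continuousAt.2 fun y => (hψd y).continuousAt
  have hslope : Continuous (dslope ψ 0) := by
    refine continuous_iff_continuousAt.2 fun y => ?_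
    rcases eq_or_ne y 0 with rfl | hy
    · exact continuousAt_dslope_same.2 (hψd 0).differentiableAt
    · exact (continuousAt_dslope_of_ne hy).2 hψc.continuousAt
  set g : ℝ → ℝ := fun y => dslope ψ 0 y / deriv ψ y - 1 with hg
  have hgc : Continuous g := (hslope.div hψ'c fun y => (hψ'pos y).ne').sub continuous_const
  have hgl : ∀ y ∈ Set.Ioc 0 B, lam y = g y := by
    intro y hy
    rw [hlam y hy.1 hy.2, hg]
    simp only [dslope_of_ne _ hy.1.ne', slope_def_field, hψ0, sub_zero, div_div]
  have hg0 : ∀ y ∈ Set.Ioc 0 B, 0 ≤ g y := by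
    intro y hy
    obtain ⟨x, hx, hxy⟩ := exists_deriv_eq_slope ψ hy.1 hψc.continuousOn
      fun z _ => (hψd z).differentiableAt.differentiableWithinAt
    have h := hψ'anti (hx.2.le.trans hy.2) hy.2 hx.2.le
    simp only [hg, sub_nonneg, dslope_of_ne _ hy.1.ne', slope_def_field]
    rwa [one_le_div (hψ'pos y), ← hxy]
  have hLamg : ∀ y ∈ Set.Icc (b p) B, Lam y = ∫ z in (b p)..y, g z := by
    intro y hy
    rw [hLam y hy.1 hy.2]
    refine intervalIntegral.integral_congr_uIoo fun z hz => ?_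
    rw [Set.uIoo_of_le hy.1] at hz
    exact hgl z ⟨hbp.1.trans_lt hz.1, hz.2.le.trans hy.2⟩
  have hint (x y : ℝ) : IntervalIntegrable g MeasureTheory.volume x y :=
    hgc.intervalIntegrable x y
  have hm : MonotoneOn Lam (Set.Icc (b p) B) := by
    intro x hx y hy hxy
    rw [hLamg x hx, hLamg y hy, ← sub_nonneg,
      intervalIntegral.integral_interval_sub_left (hint _ _) (hint _ _),
      intervalIntegral.integral_of_le hxy]
    exact MeasureTheory.setIntegral_nonneg measurableSet_Ioc fun z hz =>
      hg0 z ⟨(hbp.1.trans hx.1).trans_lt hz.1, hz.2.trans hy.2⟩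
  have hc : ContinuousOn Lam (Set.Icc (b p) B) :=
    (intervalIntegral.continuous_primitive hint (b p)).continuousOn.congr hLamg
  have ha : Lam (b p) = 0 := by
    rw [hLamg _ (Set.left_mem_Icc.2 hbp.2), intervalIntegral.integral_same]
  obtain ⟨hs, hsc, hbij⟩ := bijOn_add_id_of_monotoneOn hbp.2 hm hc ha
  have hBmem : B ∈ Set.Icc (b p) B := Set.right_mem_Icc.2 hbp.2
  have hM : b p ≤ Lam B + B := (hbij.mapsTo hBmem).1
  have hf : ∀ y ∈ Set.Ici (b p), f y ∈ Set.Icc (b p) B ∧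
      Lam (f y) + f y = min y (Lam B + B) := by
    intro y hy
    rcases le_or_gt y (Lam B + B) with h | h
    · rw [min_eq_left h]
      exact hf₁ y hy h
    · rw [min_eq_right h.le, hf₂ y h]
      exact ⟨hBmem, rfl⟩
  obtain ⟨hfm, hfl⟩ := monotoneOn_and_lipschitzOnWith_of_add_eq_min hm hf
  refine ⟨hm, hc, hs, hsc, hbij, ?_, hfm, hfl.continuousOn, ?_, ?_⟩
  · intro y hy
    obtain ⟨z, hz, hzy⟩ := hbij.surjOn hy
    exact ⟨z, ⟨hz, hzy⟩, fun w hw => hs.injOn hw.1 hz (hw.2.trans hzy.symm)⟩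
  · have h := hf₁ (b p) le_rfl hM
    exact hs.injOn h.1 (Set.left_mem_Icc.2 hbp.2) (by simp only [h.2, ha, zero_add])
  · intro y hy
    have h := hf y (hM.trans hy)
    exact hs.injOn h.1 hBmem (by simp only [h.2, min_eq_right hy])
end

section
/- (Pathwise version of Proposition 4.1.) One has τ_B = inf{t ≥ 0 : Y_t ≥ Λ(B) + B}, and for every t ∈ [0, τ_B]: X̄_t = f(Ȳ_t) and X_t = Y_t − Λ(X̄_t). That is, X solves the perturbed equation X_t = Y_t − Λ(max(b(p), sup_{0≤s≤t} X_s)) on [0, τ_B]. -/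
open Set MeasureTheory in
/-- If `ψ 0 = 0` and `ψ` is increasing and concave on `[0, B]`, then
`ψ y / (y * ψ' y) - 1` is nonnegative and integrable on `(0, B]`. -/
theorem div_mul_deriv_sub_one_nonneg_and_integrable
    {ψ ψ' lam : ℝ → ℝ} {B : ℝ} (hB : 0 ≤ B) (hψ0 : ψ 0 = 0)
    (hderiv : ∀ y, HasDerivAt ψ (ψ' y) y) (hcont : Continuous ψ')
    (hpos : ∀ y, 0 < ψ' y) (hanti : AntitoneOn ψ' (Icc 0 B))
    (hlam : ∀ y, 0 < y → y ≤ B → lam y = ψ y / (y * ψ' y) - 1) :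
    (∀ y ∈ Ioc 0 B, 0 ≤ lam y) ∧ IntervalIntegrable lam volume 0 B := by
  have hψcont : Continuous ψ :=
    continuous_iff_continuousAt.2 fun y => (hderiv y).continuousAt
  have key : ∀ y ∈ Ioc 0 B, ∃ ξ ∈ Ioo 0 y, ψ y = y * ψ' ξ := by
    intro y hy
    obtain ⟨ξ, hξ, h⟩ := exists_hasDerivAt_eq_slope ψ ψ' hy.1 hψcont.continuousOn
      fun z _ => hderiv z
    refine ⟨ξ, hξ, ?_⟩
    rw [h, hψ0]
    field_simp [hy.1.ne']
    ring
  have hnonneg : ∀ y ∈ Ioc 0 B, 0 ≤ lam y := by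
    intro y hy
    obtain ⟨ξ, hξ, h⟩ := key y hy
    have hle : ψ' y ≤ ψ' ξ :=
      hanti ⟨hξ.1.le, hξ.2.le.trans hy.2⟩ ⟨hy.1.le, hy.2⟩ hξ.2.le
    rw [hlam y hy.1 hy.2, sub_nonneg, one_le_div (mul_pos hy.1 (hpos y)), h]
    exact mul_le_mul_of_nonneg_left hle hy.1.le
  refine ⟨hnonneg, ?_⟩
  have hbound : ∀ y ∈ Ioc 0 B, lam y ≤ ψ' 0 / ψ' B := by
    intro y hy
    obtain ⟨ξ, hξ, h⟩ := key y hy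
    have hξB : ξ ≤ B := hξ.2.le.trans hy.2
    have hle : ψ' ξ ≤ ψ' 0 := hanti ⟨le_rfl, hB⟩ ⟨hξ.1.le, hξB⟩ hξ.1.le
    have hge : ψ' B ≤ ψ' y := hanti ⟨hy.1.le, hy.2⟩ ⟨hB, le_rfl⟩ hy.2
    rw [hlam y hy.1 hy.2, h, mul_div_mul_left _ _ hy.1.ne']
    have := div_le_div₀ (hpos 0).le hle (hpos B) hge
    linarith
  have hcontOn : ContinuousOn lam (Ioc 0 B) := by
    have h : ContinuousOn (fun y => ψ y / (y * ψ' y) - 1) (Ioc 0 B) := by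
      refine (hψcont.continuousOn.div (continuous_id.mul hcont).continuousOn ?_).sub
        continuousOn_const
      intro y hy
      exact (mul_pos hy.1 (hpos y)).ne'
    exact h.congr fun y hy => hlam y hy.1 hy.2
  rw [intervalIntegrable_iff_integrableOn_Ioc_of_le hB]
  refine IntegrableOn.of_bound (by simp) (hcontOn.aestronglyMeasurable measurableSet_Ioc)
    (ψ' 0 / ψ' B) ?_
  filter_upwards [ae_restrict_mem measurableSet_Ioc] with y hy
  rw [Real.norm_of_nonneg (hnonneg y hy)]
  exact hbound y hy

/-- The derivative of a difference of exponentials is nonincreasing up to the inflection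
point. -/
theorem antitoneOn_exp_sub_exp {a d B : ℝ} (ha : a < 0) (hd : 0 < d)
    (hB : B = (Real.log (a ^ 2) - Real.log (d ^ 2)) / (d - a)) :
    AntitoneOn (fun y => (d * Real.exp (d * y) - a * Real.exp (a * y)) / (d - a))
      (Set.Icc 0 B) := by
  have hda : 0 < d - a := by linarith
  have hderiv : ∀ y, HasDerivAt
      (fun y => (d * Real.exp (d * y) - a * Real.exp (a * y)) / (d - a))
      ((d ^ 2 * Real.exp (d * y) - a ^ 2 * Real.exp (a * y)) / (d - a)) y := by
    intro y
    have h₁ := (((hasDerivAt_id y).const_mul d).exp).const_mul d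
    have h₂ := (((hasDerivAt_id y).const_mul a).exp).const_mul a
    refine ((h₁.sub h₂).div_const (d - a)).congr_deriv ?_
    simp only [id]
    ring
  refine antitoneOn_of_hasDerivWithinAt_nonpos (convex_Icc 0 B)
    (fun y _ => (hderiv y).continuousAt.continuousWithinAt)
    (fun y _ => (hderiv y).hasDerivWithinAt) ?_
  intro y hy
  rw [interior_Icc] at hy
  refine div_nonpos_of_nonpos_of_nonneg (sub_nonpos.2 ?_) hda.le
  have hyB : y * (d - a) ≤ Real.log (a ^ 2) - Real.log (d ^ 2) := by
    rw [← le_div_iff₀ hda, ← hB]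
    exact hy.2.le
  have ha2 : 0 < a ^ 2 := sq_pos_of_neg ha
  have hd2 : 0 < d ^ 2 := by positivity
  rw [← Real.exp_log ha2, ← Real.exp_log hd2, ← Real.exp_add, ← Real.exp_add, Real.exp_le_exp]
  linarith

open Set in
/-- Pathwise construction of the solution to the equation perturbed by its running maximum,
for a nonnegative monotone perturbation `Lam` started at level `β`. -/
theorem perturbed_equation_of_monotoneOn
    {β B : ℝ} (hβB : β ≤ B) {Lam f : ℝ → ℝ}
    (hLamβ : Lam β = 0) (hmono : MonotoneOn Lam (Icc β B))
    (hf₁ : ∀ y, β ≤ y → y ≤ Lam B + B → f y ∈ Icc β B ∧ Lam (f y) + f y = y)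
    (hf₂ : ∀ y, Lam B + B < y → f y = B)
    {Y Ybar X Xbar : ℝ → ℝ} (hYcont : Continuous Y) (hY0 : Y 0 ≤ β)
    (hYbar : ∀ t, Ybar t = max β (sSup (Y '' Icc 0 t)))
    (hX : ∀ t, X t = Y t - Ybar t + f (Ybar t))
    (hXbar : ∀ t, Xbar t = max β (sSup (X '' Icc 0 t)))
    {τB : ENNReal} (hτB : τB = ⨅ (t : ℝ) (_ : 0 ≤ t ∧ B ≤ X t), ENNReal.ofReal t) :
    τB = (⨅ (t : ℝ) (_ : 0 ≤ t ∧ Lam B + B ≤ Y t), ENNReal.ofReal t) ∧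
      ∀ t : ℝ, 0 ≤ t → ENNReal.ofReal t ≤ τB →
        Xbar t = f (Ybar t) ∧ X t = Y t - Lam (Xbar t) := by
  have hstrict : StrictMonoOn (fun z => Lam z + z) (Icc β B) :=
    hmono.add_strictMono strictMonoOn_id
  have hβmem : β ∈ Icc β B := ⟨le_rfl, hβB⟩
  have hBmem : B ∈ Icc β B := ⟨hβB, le_rfl⟩
  have hLamB : 0 ≤ Lam B := hLamβ ▸ hmono hβmem hBmem hβB
  have hβ : β ≤ Lam B + B := by linarith
  have hf_β : f β = β := by
    obtain ⟨hm, he⟩ := hf₁ β le_rfl hβ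
    exact hstrict.injOn hm hβmem (by simp only [he, hLamβ, zero_add])
  have hf_top : ∀ y, Lam B + B ≤ y → f y = B := by
    intro y hy
    rcases hy.eq_or_lt with rfl | hy
    · obtain ⟨hm, he⟩ := hf₁ _ hβ le_rfl
      exact hstrict.injOn hm hBmem he
    · exact hf₂ y hy
  have hf_le : ∀ y, β ≤ y → f y ≤ B := by
    intro y hy
    rcases le_total y (Lam B + B) with h | h
    · exact (hf₁ y hy h).1.2
    · exact (hf_top y h).le
  have hf_mono : ∀ y z, β ≤ y → y ≤ z → z ≤ Lam B + B → f y ≤ f z := by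
    intro y z hy hyz hz
    obtain ⟨hm, he⟩ := hf₁ y hy (hyz.trans hz)
    obtain ⟨hm', he'⟩ := hf₁ z (hy.trans hyz) hz
    refine (hstrict.le_iff_le hm hm').1 ?_
    simpa only [he, he'] using hyz
  have hbdd : ∀ t, BddAbove (Y '' Icc 0 t) := fun t =>
    (isCompact_Icc.image hYcont).bddAbove
  have hβYbar : ∀ t, β ≤ Ybar t := fun t => hYbar t ▸ le_max_left _ _
  have hY_le : ∀ s t, 0 ≤ s → s ≤ t → Y s ≤ Ybar t := by
    intro s t hs hst
    rw [hYbar]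
    exact (le_csSup (hbdd t) ⟨s, ⟨hs, hst⟩, rfl⟩).trans (le_max_right _ _)
  have hYbar_le : ∀ t a, 0 ≤ t → β ≤ a → (∀ s, 0 ≤ s → s ≤ t → Y s ≤ a) → Ybar t ≤ a := by
    intro t a ht ha h
    rw [hYbar]
    refine max_le ha (csSup_le ((nonempty_Icc.2 ht).image Y) ?_)
    rintro _ ⟨s, hs, rfl⟩
    exact h s hs.1 hs.2
  have hYbar_mono : ∀ s t, 0 ≤ s → s ≤ t → Ybar s ≤ Ybar t := fun s t hs hst =>
    hYbar_le s _ hs (hβYbar t) fun u hu hus => hY_le u t hu (hus.trans hst)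
  have hmax : ∀ t, 0 ≤ t → β ≤ sSup (Y '' Icc 0 t) →
      ∃ s, 0 ≤ s ∧ s ≤ t ∧ Y s = Ybar t ∧ Ybar s = Ybar t := by
    intro t ht hle
    obtain ⟨s, hs, hsup⟩ :=
      isCompact_Icc.exists_sSup_image_eq (nonempty_Icc.2 ht) hYcont.continuousOn
    have hYs : Y s = Ybar t := by rw [hYbar, max_eq_right hle, hsup]
    refine ⟨s, hs.1, hs.2, hYs, le_antisymm (hYbar_mono s t hs.1 hs.2) ?_⟩
    rw [← hYs]
    exact hY_le s s hs.1 le_rfl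
  have hτ : τB = ⨅ (t : ℝ) (_ : 0 ≤ t ∧ Lam B + B ≤ Y t), ENNReal.ofReal t := by
    rw [hτB]
    apply le_antisymm
    · refine le_iInf₂ fun t ht => ?_
      have hle : Lam B + B ≤ sSup (Y '' Icc 0 t) :=
        ht.2.trans (le_csSup (hbdd t) ⟨t, ⟨ht.1, le_rfl⟩, rfl⟩)
      obtain ⟨s, hs0, hst, hYs, hYbs⟩ := hmax t ht.1 (hβ.trans hle)
      refine (iInf₂_le s ⟨hs0, ?_⟩).trans (ENNReal.ofReal_le_ofReal hst)
      rw [hX, hYbs, hYs, hf_top _ (ht.2.trans (hY_le t t ht.1 le_rfl))]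
      linarith
    · refine le_iInf₂ fun t ht => iInf₂_le t ⟨ht.1, ?_⟩
      have h := ht.2
      rw [hX] at h
      have h₁ := hf_le _ (hβYbar t)
      have h₂ := hY_le t t ht.1 le_rfl
      by_contra hlt
      have hfB : f (Ybar t) = B := by linarith
      have hYt : Ybar t = Y t := by linarith
      have h₃ := (hf₁ (Ybar t) (hβYbar t) (by linarith)).2
      rw [hfB] at h₃
      linarith
  refine ⟨hτ, fun t ht htτ => ?_⟩
  have hYbar_top : Ybar t ≤ Lam B + B := by
    refine hYbar_le t _ ht hβ fun s hs hst => ?_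
    by_contra! hlt
    obtain ⟨u, hu, hYu⟩ :=
      intermediate_value_Icc hs hYcont.continuousOn ⟨hY0.trans hβ, hlt.le⟩
    have hus : u < s := hu.2.lt_of_ne (by rintro rfl; linarith)
    have h : ENNReal.ofReal t ≤ ENNReal.ofReal u :=
      htτ.trans (hτ ▸ iInf₂_le u ⟨hu.1, hYu.ge⟩)
    rw [ENNReal.ofReal_le_ofReal_iff hu.1] at h
    linarith
  obtain ⟨hfmem, hfeq⟩ := hf₁ _ (hβYbar t) hYbar_top
  have hX_le : ∀ s ∈ Icc 0 t, X s ≤ f (Ybar t) := by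
    intro s hs
    rw [hX]
    have h₁ := hY_le s s hs.1 le_rfl
    have h₂ := hf_mono _ _ (hβYbar s) (hYbar_mono s t hs.1 hs.2) hYbar_top
    linarith
  have hXbar_eq : Xbar t = f (Ybar t) := by
    rw [hXbar]
    apply le_antisymm
    · refine max_le hfmem.1 (csSup_le ((nonempty_Icc.2 ht).image X) ?_)
      rintro _ ⟨s, hs, rfl⟩
      exact hX_le s hs
    · rcases le_total (sSup (Y '' Icc 0 t)) β with hle | hle
      · have h : Ybar t = β := by rw [hYbar, max_eq_left hle]
        rw [h, hf_β]
        exact le_max_left _ _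
      · obtain ⟨s, hs0, hst, hYs, hYbs⟩ := hmax t ht hle
        have hXs : X s = f (Ybar t) := by rw [hX, hYbs, hYs]; ring
        refine le_trans ?_ (le_max_right _ _)
        refine le_csSup ⟨f (Ybar t), ?_⟩ ⟨s, ⟨hs0, hst⟩, hXs⟩
        rintro _ ⟨u, hu, rfl⟩
        exact hX_le u hu
  refine ⟨hXbar_eq, ?_⟩
  rw [hXbar_eq, hX]
  linarith

/-- pathwise version of Proposition 4.1. With `X_t = Y_t − Ȳ_t + f(Ȳ_t)`,
the hitting time `τ_B` of `B` by `X` equals the hitting time of `Λ(B) + B` by `Y`, and for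
every `t ∈ [0, τ_B]` one has `X̄_t = f(Ȳ_t)` and `X_t = Y_t − Λ(X̄_t)`; i.e. `X` solves the
perturbed equation `X_t = Y_t − Λ(max(b(p), sup_{0≤s≤t} X_s))` on `[0, τ_B]`. -/
theorem deFinetti_perturbed_BM_solves_equation
    (μ σ r : ℝ) (hμ : 0 < μ) (hσ : 0 < σ) (hr : 0 < r)
    (ζ₁ ζ₂ : ℝ)
    (hζ₁ : ζ₁ = (-μ - Real.sqrt (μ ^ 2 + 2 * r * σ ^ 2)) / σ ^ 2)
    (hζ₂ : ζ₂ = (-μ + Real.sqrt (μ ^ 2 + 2 * r * σ ^ 2)) / σ ^ 2)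
    (ψ : ℝ → ℝ)
    (hψ : ∀ y : ℝ, ψ y = (Real.exp (ζ₂ * y) - Real.exp (ζ₁ * y)) / (ζ₂ - ζ₁))
    (B : ℝ) (hB : B = (Real.log (ζ₁ ^ 2) - Real.log (ζ₂ ^ 2)) / (ζ₂ - ζ₁))
    (V : ℝ → ℝ)
    (hV₁ : ∀ y : ℝ, y ≤ B → V y = ψ y / deriv ψ B)
    (hV₂ : ∀ y : ℝ, B < y → V y = y - B + V B)
    (c : ℝ → ℝ)
    (hc₁ : ∀ y : ℝ, 0 ≤ y → y ≤ B → c y = (deriv V y - 1) / deriv V y)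
    (hc₂ : ∀ y : ℝ, B < y → c y = 0)
    (phat : ℝ) (hphat : phat = (deriv V 0 - 1) / deriv V 0)
    (b : ℝ → ℝ)
    (hb₁ : ∀ q : ℝ, 0 ≤ q → q ≤ phat → b q ∈ Set.Icc 0 B ∧ c (b q) = q)
    (hb₂ : ∀ q : ℝ, phat < q → q ≤ 1 → b q = 0)
    (lam : ℝ → ℝ)
    (hlam : ∀ y : ℝ, 0 < y → y ≤ B → lam y = ψ y / (y * deriv ψ y) - 1)
    (p : ℝ) (hp : p ∈ Set.Icc (0 : ℝ) 1)
    (Lam : ℝ → ℝ)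
    (hLam : ∀ y : ℝ, b p ≤ y → y ≤ B → Lam y = ∫ z in (b p)..y, lam z)
    (f : ℝ → ℝ)
    (hf₁ : ∀ y : ℝ, b p ≤ y → y ≤ Lam B + B →
      f y ∈ Set.Icc (b p) B ∧ Lam (f y) + f y = y)
    (hf₂ : ∀ y : ℝ, Lam B + B < y → f y = B)
    (x : ℝ) (hx : x ∈ Set.Icc 0 (b p))
    (Y : ℝ → ℝ) (hYcont : Continuous Y) (hY0 : Y 0 = x)
    (Ybar : ℝ → ℝ)
    (hYbar : ∀ t : ℝ, Ybar t = max (b p) (sSup (Y '' Set.Icc 0 t)))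
    (X : ℝ → ℝ)
    (hX : ∀ t : ℝ, X t = Y t - Ybar t + f (Ybar t))
    (Xbar : ℝ → ℝ)
    (hXbar : ∀ t : ℝ, Xbar t = max (b p) (sSup (X '' Set.Icc 0 t)))
    (τB : ENNReal)
    (hτB : τB = ⨅ (t : ℝ) (_ : 0 ≤ t ∧ B ≤ X t), ENNReal.ofReal t) :
    τB = (⨅ (t : ℝ) (_ : 0 ≤ t ∧ Lam B + B ≤ Y t), ENNReal.ofReal t) ∧
      ∀ t : ℝ, 0 ≤ t → ENNReal.ofReal t ≤ τB →
        Xbar t = f (Ybar t) ∧ X t = Y t - Lam (Xbar t) := by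
  have hσ2 : 0 < σ ^ 2 := by positivity
  set S := Real.sqrt (μ ^ 2 + 2 * r * σ ^ 2)
  have hμS : μ < S := by
    apply Real.lt_sqrt_of_sq_lt
    have : 0 < 2 * r * σ ^ 2 := by positivity
    linarith
  have hζ₁neg : ζ₁ < 0 := by
    rw [hζ₁]
    exact div_neg_of_neg_of_pos (by linarith) hσ2
  have hζ₂pos : 0 < ζ₂ := by
    rw [hζ₂]
    exact div_pos (by linarith) hσ2
  have hζ : 0 < ζ₂ - ζ₁ := by linarith
  have hsum : ζ₂ < -ζ₁ := by
    rw [hζ₁, hζ₂, ← neg_div]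
    exact div_lt_div_of_pos_right (by linarith) hσ2
  have hBnonneg : 0 ≤ B := by
    rw [hB]
    refine div_nonneg (sub_nonneg.2 (Real.log_le_log (by positivity) ?_)) hζ.le
    nlinarith
  have hbp : b p ∈ Set.Icc 0 B := by
    rcases le_or_gt p phat with h | h
    · exact (hb₁ p hp.1 h).1
    · rw [hb₂ p h hp.2]
      exact ⟨le_rfl, hBnonneg⟩
  have hψderiv : ∀ y, HasDerivAt ψ
      ((ζ₂ * Real.exp (ζ₂ * y) - ζ₁ * Real.exp (ζ₁ * y)) / (ζ₂ - ζ₁)) y := by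
    intro y
    rw [funext hψ]
    have h₁ := ((hasDerivAt_id y).const_mul ζ₂).exp
    have h₂ := ((hasDerivAt_id y).const_mul ζ₁).exp
    refine ((h₁.sub h₂).div_const (ζ₂ - ζ₁)).congr_deriv ?_
    simp only [id]
    ring
  obtain ⟨hnonneg, hint⟩ := div_mul_deriv_sub_one_nonneg_and_integrable (lam := lam) hBnonneg
    (by simp [hψ]) hψderiv (by fun_prop)
    (fun y => div_pos (by nlinarith [mul_pos hζ₂pos (Real.exp_pos (ζ₂ * y)),
      mul_pos_of_neg_of_neg hζ₁neg (neg_lt_zero.2 (Real.exp_pos (ζ₁ * y)))]) hζ)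
    (antitoneOn_exp_sub_exp hζ₁neg hζ₂pos hB)
    (fun y hy hyB => by rw [hlam y hy hyB, (hψderiv y).deriv])
  have hint' : ∀ y z, 0 ≤ y → y ≤ z → z ≤ B →
      IntervalIntegrable lam MeasureTheory.volume y z := fun y z hy hyz hz =>
    hint.mono_set (by
      rw [Set.uIcc_of_le hyz, Set.uIcc_of_le hBnonneg]
      exact Set.Icc_subset_Icc hy hz)
  have hmono : MonotoneOn Lam (Set.Icc (b p) B) := by
    intro y hy z hz hyz
    have hy0 : 0 ≤ y := hbp.1.trans hy.1
    rw [hLam y hy.1 hy.2, hLam z hz.1 hz.2,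
      ← intervalIntegral.integral_add_adjacent_intervals
        (hint' (b p) y hbp.1 hy.1 hy.2) (hint' y z hy0 hyz hz.2)]
    refine le_add_of_nonneg_right ?_
    rw [intervalIntegral.integral_of_le hyz]
    exact MeasureTheory.setIntegral_nonneg measurableSet_Ioc fun w hw =>
      hnonneg w ⟨hy0.trans_lt hw.1, hw.2.trans hz.2⟩
  exact perturbed_equation_of_monotoneOn hbp.2
    (by rw [hLam _ le_rfl hbp.2, intervalIntegral.integral_same]) hmono hf₁ hf₂ hYcont
    (hY0.trans_le hx.2) hYbar hX hXbar hτB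
end

section
/- For every x ≥ 0 and every p ∈ [0,1]: max(x, (1−p)V(x)) ≤ v(x,p) ≤ V(x). In particular, the equilibrium value of Player 1 lies between the lower bound (1−p)V(x) and the single-player value V(x), and is at least the amount x available for immediate extraction. -/
open Set

/-- Gluing two functions at a point where values and derivatives agree. -/
lemma hasDerivAt_of_eqOn_Iic_Ici {F f g : ℝ → ℝ} {a d : ℝ}
    (hf : HasDerivAt f d a) (hg : HasDerivAt g d a)
    (hFf : EqOn F f (Iic a)) (hFg : EqOn F g (Ici a)) : HasDerivAt F d a := by
  have h₁ : HasDerivWithinAt F d (Iic a) a :=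
    hf.hasDerivWithinAt.congr hFf (hFf self_mem_Iic)
  have h₂ : HasDerivWithinAt F d (Ici a) a :=
    hg.hasDerivWithinAt.congr hFg (hFg self_mem_Ici)
  have h := h₁.union h₂
  rwa [Iic_union_Ici, hasDerivWithinAt_univ] at h

lemma le_mul_sub_of_antitone_deriv {V : ℝ → ℝ} (hV : Differentiable ℝ V)
    (hanti : Antitone (deriv V)) {x y : ℝ} (hxy : x ≤ y) :
    deriv V y * (y - x) ≤ V y - V x ∧ V y - V x ≤ deriv V x * (y - x) := by
  constructor
  · refine (convex_Icc x y).mul_sub_le_image_sub_of_le_deriv hV.continuous.continuousOn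
      hV.differentiableOn (fun z hz => hanti (interior_subset hz).2)
      x (left_mem_Icc.2 hxy) y (right_mem_Icc.2 hxy) hxy
  · refine (convex_Icc x y).image_sub_le_mul_sub_of_deriv_le hV.continuous.continuousOn
      hV.differentiableOn (fun z hz => hanti (interior_subset hz).1)
      x (left_mem_Icc.2 hxy) y (right_mem_Icc.2 hxy) hxy

/-- The barrier value function is differentiable and concave, with slope at least one. -/
lemma barrier_value_regular {a k B : ℝ} {V : ℝ → ℝ} (ha : 0 < a) (hk : 0 < k)
    {ψ : ℝ → ℝ}
    (hψ : ∀ y : ℝ, ψ y = (Real.exp (a * y) - Real.exp (-k * y)) / (a + k))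
    (hB : a ^ 2 * Real.exp (a * B) = k ^ 2 * Real.exp (-k * B))
    (hV₁ : ∀ y : ℝ, y ≤ B → V y = ψ y / deriv ψ B)
    (hV₂ : ∀ y : ℝ, B < y → V y = y - B + V B) :
    Differentiable ℝ V ∧ Antitone (deriv V) ∧ ∀ y, 1 ≤ deriv V y := by
  set D : ℝ → ℝ := fun y => (a * Real.exp (a * y) + k * Real.exp (-k * y)) / (a + k) with hD
  have hder : ∀ y, HasDerivAt ψ (D y) y := by
    intro y
    have e : ∀ m : ℝ, HasDerivAt (fun z => Real.exp (m * z)) (m * Real.exp (m * y)) y := by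
      intro m
      have h := ((hasDerivAt_id y).const_mul m).exp
      simpa [mul_comm] using h
    have h := ((e a).sub (e (-k))).div_const (a + k)
    rw [show ψ = _ from funext hψ]
    refine h.congr_deriv ?_
    simp only [hD]
    ring
  have hDder : ∀ y, HasDerivAt D
      ((a ^ 2 * Real.exp (a * y) - k ^ 2 * Real.exp (-k * y)) / (a + k)) y := by
    intro y
    have e : ∀ m : ℝ, HasDerivAt (fun z => Real.exp (m * z)) (m * Real.exp (m * y)) y := by
      intro m
      have h := ((hasDerivAt_id y).const_mul m).exp
      simpa [mul_comm] using h
    have h := (((e a).const_mul a).add ((e (-k)).const_mul k)).div_const (a + k)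
    refine h.congr_deriv ?_
    ring
  have hDpos : ∀ y, 0 < D y := fun y => by simp only [hD]; positivity
  have hDanti : AntitoneOn D (Iic B) := by
    refine antitoneOn_of_deriv_nonpos (convex_Iic B)
      (fun y _ => (hDder y).continuousAt.continuousWithinAt)
      (fun y _ => (hDder y).differentiableAt.differentiableWithinAt) fun y hy => ?_
    have hyB : y ∈ Iic B := interior_subset hy
    rw [mem_Iic] at hyB
    rw [(hDder y).deriv]
    refine div_nonpos_of_nonpos_of_nonneg ?_ (by positivity)
    have h₁ : Real.exp (a * y) ≤ Real.exp (a * B) := by gcongr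
    have h₂ : Real.exp (-k * B) ≤ Real.exp (-k * y) := Real.exp_le_exp.2 (by nlinarith)
    have h₃ := mul_le_mul_of_nonneg_left h₁ (sq_nonneg a)
    have h₄ := mul_le_mul_of_nonneg_left h₂ (sq_nonneg k)
    linarith
  rw [(hder B).deriv] at hV₁
  have hlin : ∀ y, HasDerivAt (fun z => z - B + V B) 1 y := fun y =>
    ((hasDerivAt_id y).sub_const B).add_const (V B)
  have hle : ∀ y, y ≤ B → HasDerivAt V (D y / D B) y := by
    intro y hy
    rcases hy.lt_or_eq with h | rfl
    · refine ((hder y).div_const (D B)).congr_of_eventuallyEq ?_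
      filter_upwards [Iio_mem_nhds h] with z hz using hV₁ z (le_of_lt hz)
    · refine hasDerivAt_of_eqOn_Iic_Ici ((hder y).div_const (D y)) ?_ (fun z hz => hV₁ z hz)
        (g := fun z => z - y + V y) ?_
      · rw [div_self (hDpos y).ne']
        exact hlin y
      · intro z hz
        rcases (mem_Ici.1 hz).lt_or_eq with h | rfl
        · exact hV₂ z h
        · simp
  have hgt : ∀ y, B < y → HasDerivAt V 1 y := by
    intro y hy
    refine (hlin y).congr_of_eventuallyEq ?_
    filter_upwards [Ioi_mem_nhds hy] with z hz using hV₂ z hz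
  have hone : ∀ y, 1 ≤ deriv V y := by
    intro y
    rcases le_or_gt y B with h | h
    · rw [(hle y h).deriv, one_le_div (hDpos B)]
      exact hDanti h self_mem_Iic h
    · rw [(hgt y h).deriv]
  refine ⟨fun y => ?_, fun x y hxy => ?_, hone⟩
  · rcases le_or_gt y B with h | h
    · exact (hle y h).differentiableAt
    · exact (hgt y h).differentiableAt
  · rcases le_or_gt y B with h | h
    · rw [(hle y h).deriv, (hle x (hxy.trans h)).deriv]
      exact div_le_div_of_nonneg_right (hDanti (hxy.trans h) h hxy) (hDpos B).le
    · rw [(hgt y h).deriv]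
      exact hone x

/-- The value bounds for a concave `V` with slope at least one and a threshold `β` at which
`(1 - p) V'` has reached one. -/
lemma threshold_value_bounds {V : ℝ → ℝ} (hV : Differentiable ℝ V)
    (hanti : Antitone (deriv V)) (hone : ∀ y, 1 ≤ deriv V y) (hV0 : V 0 = 0)
    {p β w x : ℝ} (hp0 : 0 ≤ p) (hp1 : p ≤ 1) (hβ0 : 0 ≤ β)
    (hβ : (1 - p) * deriv V β ≤ 1) (hβ' : β = 0 ∨ (1 - p) * deriv V β = 1)
    (hx : 0 ≤ x) (hw₁ : x ≤ β → w = (1 - p) * V x)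
    (hw₂ : β < x → w = (1 - p) * V β + x - β) :
    max x ((1 - p) * V x) ≤ w ∧ w ≤ V x := by
  have hq : 0 ≤ 1 - p := by linarith
  have hnonneg : ∀ y, 0 ≤ y → 0 ≤ V y := by
    intro y hy
    have h := (le_mul_sub_of_antitone_deriv hV hanti hy).1
    have := hone y
    nlinarith
  have hmin : ∀ y, 0 ≤ y → y ≤ β → y ≤ (1 - p) * V y := by
    intro y hy hyβ
    rcases hβ' with h | h
    · obtain rfl : y = 0 := by linarith
      simp [hV0]
    · have h₁ := (le_mul_sub_of_antitone_deriv hV hanti hy).1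
      have h₂ : 1 ≤ (1 - p) * deriv V y :=
        h.ge.trans (mul_le_mul_of_nonneg_left (hanti hyβ) hq)
      have h₃ := mul_le_mul_of_nonneg_left h₁ hq
      rw [hV0] at h₃
      nlinarith [mul_le_mul_of_nonneg_right h₂ hy]
  rcases le_or_gt x β with h | h
  · rw [hw₁ h]
    refine ⟨max_le (hmin x hx h) le_rfl, ?_⟩
    nlinarith [hnonneg x hx]
  · rw [hw₂ h]
    obtain ⟨h₁, h₂⟩ := le_mul_sub_of_antitone_deriv hV hanti h.le
    have hsub : 0 ≤ x - β := by linarith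
    refine ⟨max_le ?_ ?_, ?_⟩
    · linarith [hmin β hβ0 le_rfl]
    · nlinarith [mul_le_mul_of_nonneg_left h₂ hq, mul_le_mul_of_nonneg_right hβ hsub]
    · nlinarith [mul_le_mul_of_nonneg_right (hone x) hsub, mul_nonneg hp0 (hnonneg β hβ0)]


/-- For every `x ≥ 0` and `p ∈ [0,1]`:
`max(x, (1−p)V(x)) ≤ v(x,p) ≤ V(x)`, where `v` is the equilibrium value of Player 1. -/
theorem deFinetti_equilibrium_value_bounds
    (μ σ r : ℝ) (hμ : 0 < μ) (hσ : 0 < σ) (hr : 0 < r)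
    (ζ₁ ζ₂ : ℝ)
    (hζ₁ : ζ₁ = (-μ - Real.sqrt (μ ^ 2 + 2 * r * σ ^ 2)) / σ ^ 2)
    (hζ₂ : ζ₂ = (-μ + Real.sqrt (μ ^ 2 + 2 * r * σ ^ 2)) / σ ^ 2)
    (ψ : ℝ → ℝ)
    (hψ : ∀ y : ℝ, ψ y = (Real.exp (ζ₂ * y) - Real.exp (ζ₁ * y)) / (ζ₂ - ζ₁))
    (B : ℝ) (hB : B = (Real.log (ζ₁ ^ 2) - Real.log (ζ₂ ^ 2)) / (ζ₂ - ζ₁))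
    (V : ℝ → ℝ)
    (hV₁ : ∀ y : ℝ, y ≤ B → V y = ψ y / deriv ψ B)
    (hV₂ : ∀ y : ℝ, B < y → V y = y - B + V B)
    (c : ℝ → ℝ)
    (hc₁ : ∀ y : ℝ, 0 ≤ y → y ≤ B → c y = (deriv V y - 1) / deriv V y)
    (hc₂ : ∀ y : ℝ, B < y → c y = 0)
    (phat : ℝ) (hphat : phat = (deriv V 0 - 1) / deriv V 0)
    (b : ℝ → ℝ)
    (hb₁ : ∀ q : ℝ, 0 ≤ q → q ≤ phat → b q ∈ Set.Icc 0 B ∧ c (b q) = q)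
    (hb₂ : ∀ q : ℝ, phat < q → q ≤ 1 → b q = 0)
    (v : ℝ → ℝ → ℝ)
    (hv₁ : ∀ x q : ℝ, 0 ≤ x → x ≤ b q → v x q = (1 - q) * V x)
    (hv₂ : ∀ x q : ℝ, b q < x → v x q = (1 - q) * V (b q) + x - b q) :
    ∀ x : ℝ, 0 ≤ x → ∀ p ∈ Set.Icc (0 : ℝ) 1,
      max x ((1 - p) * V x) ≤ v x p ∧ v x p ≤ V x := by
  have hs : μ < Real.sqrt (μ ^ 2 + 2 * r * σ ^ 2) :=
    Real.lt_sqrt_of_sq_lt (by nlinarith [mul_pos hr (pow_pos hσ 2)])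
  have hσ2 : 0 < σ ^ 2 := by positivity
  have ha : 0 < ζ₂ := hζ₂ ▸ div_pos (by linarith) hσ2
  have hk : 0 < -ζ₁ := by
    rw [hζ₁, ← neg_div]
    exact div_pos (by linarith) hσ2
  have hak : ζ₂ ≤ -ζ₁ := by
    rw [hζ₁, hζ₂, ← neg_div]
    exact div_le_div_of_nonneg_right (by linarith) hσ2.le
  have hd : 0 < ζ₂ - ζ₁ := by linarith
  have hsq₁ : 0 < ζ₁ ^ 2 := by nlinarith
  have hsq₂ : 0 < ζ₂ ^ 2 := by positivity
  have hB0 : 0 ≤ B := by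
    rw [hB]
    refine div_nonneg (sub_nonneg.2 (Real.log_le_log hsq₂ ?_)) hd.le
    nlinarith
  have hBeq : ζ₂ ^ 2 * Real.exp (ζ₂ * B) = (-ζ₁) ^ 2 * Real.exp (-(-ζ₁) * B) := by
    have h : Real.log (ζ₂ ^ 2) + ζ₂ * B = Real.log (ζ₁ ^ 2) + ζ₁ * B := by
      have : B * (ζ₂ - ζ₁) = Real.log (ζ₁ ^ 2) - Real.log (ζ₂ ^ 2) := by
        rw [hB, div_mul_cancel₀ _ hd.ne']
      linarith
    have h' := congrArg Real.exp h
    rwa [Real.exp_add, Real.exp_add, Real.exp_log hsq₁, Real.exp_log hsq₂, ← neg_sq ζ₁,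
      ← neg_neg (ζ₁), neg_neg (-ζ₁)] at h'
  obtain ⟨hV, hanti, hone⟩ := barrier_value_regular (V := V) (ψ := ψ) ha hk
    (fun y => by rw [hψ y, neg_neg, sub_eq_add_neg ζ₂]) hBeq hV₁ hV₂
  have hV0 : V 0 = 0 := by simp [hV₁ 0 hB0, hψ]
  rintro x hx p ⟨hp0, hp1⟩
  rcases le_or_gt p phat with hp | hp
  · obtain ⟨⟨hb0, hbB⟩, hcb⟩ := hb₁ p hp0 hp
    have hpos : 0 < deriv V (b p) := zero_lt_one.trans_le (hone _)
    have heq : (1 - p) * deriv V (b p) = 1 := by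
      rw [hc₁ _ hb0 hbB, div_eq_iff hpos.ne'] at hcb
      linarith
    exact threshold_value_bounds hV hanti hone hV0 hp0 hp1 hb0 heq.le (Or.inr heq) hx
      (hv₁ x p hx) (hv₂ x p)
  · have hb := hb₂ p hp hp1
    have hpos : 0 < deriv V 0 := zero_lt_one.trans_le (hone _)
    refine threshold_value_bounds hV hanti hone hV0 hp0 hp1 hb.ge ?_ (Or.inl hb) hx
      (hv₁ x p hx) (hv₂ x p)
    rw [hphat, div_lt_iff₀ hpos] at hp
    rw [hb]
    linarith
end

section
/- For every p ∈ (0, p̂) and every y with 0 ≤ y ≤ b(p), one has (1−p)(V(b(p)) − V(y)) ≥ b(p) − y; equivalently, for any x ≥ b(p), (1−p)V(y) + (x − y) ≤ (1−p)V(b(p)) + (x − b(p)). In particular an initial lump-sum extraction below the boundary b(p) is suboptimal for Player 1. -/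
lemma hasDerivAt_expDiff (α β s : ℝ) :
    HasDerivAt (fun s => (Real.exp (β * s) - Real.exp (α * s)) / (β - α))
      ((β * Real.exp (β * s) - α * Real.exp (α * s)) / (β - α)) s := by
  have h (γ : ℝ) : HasDerivAt (fun s => Real.exp (γ * s)) (γ * Real.exp (γ * s)) s := by
    simpa [mul_comm] using ((hasDerivAt_id s).const_mul γ).exp
  exact ((h β).sub (h α)).div_const _

lemma hasDerivAt_deriv_expDiff (α β s : ℝ) :
    HasDerivAt (fun s => (β * Real.exp (β * s) - α * Real.exp (α * s)) / (β - α))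
      ((β ^ 2 * Real.exp (β * s) - α ^ 2 * Real.exp (α * s)) / (β - α)) s := by
  have h (γ : ℝ) : HasDerivAt (fun s => γ * Real.exp (γ * s)) (γ ^ 2 * Real.exp (γ * s)) s := by
    have h' : HasDerivAt (fun s => Real.exp (γ * s)) (γ * Real.exp (γ * s)) s := by
      simpa [mul_comm] using ((hasDerivAt_id s).const_mul γ).exp
    simpa [pow_two, mul_assoc] using h'.const_mul γ
  exact ((h β).sub (h α)).div_const _

/-- To the left of its inflection point, `(exp (β s) - exp (α s)) / (β - α)` is concave. -/
lemma concaveOn_expDiff {α β : ℝ} (hα : α < 0) (hβ : 0 < β) :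
    ConcaveOn ℝ (Set.Iic ((Real.log (α ^ 2) - Real.log (β ^ 2)) / (β - α)))
      (fun s => (Real.exp (β * s) - Real.exp (α * s)) / (β - α)) := by
  refine concaveOn_of_hasDerivWithinAt2_nonpos (convex_Iic _)
    (fun s _ => (hasDerivAt_expDiff α β s).continuousAt.continuousWithinAt)
    (fun s _ => (hasDerivAt_expDiff α β s).hasDerivWithinAt)
    (fun s _ => (hasDerivAt_deriv_expDiff α β s).hasDerivWithinAt) fun s hs => ?_
  have hs' := (le_div_iff₀ (by linarith)).1 (Set.mem_Iic.1 (interior_subset hs))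
  refine div_nonpos_of_nonpos_of_nonneg (sub_nonpos.2 ?_) (by linarith)
  rw [← Real.exp_log (pow_pos hβ 2), ← Real.exp_log (sq_pos_of_neg hα), ← Real.exp_add,
    ← Real.exp_add, Real.exp_le_exp]
  linarith


/-- For every `p ∈ (0, p̂)` and `0 ≤ y ≤ b(p)`:
`(1−p)(V(b(p)) − V(y)) ≥ b(p) − y`; equivalently, for any `x ≥ b(p)`,
`(1−p)V(y) + (x − y) ≤ (1−p)V(b(p)) + (x − b(p))`: an initial lump-sum extraction below
the boundary `b(p)` is suboptimal for Player 1. -/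
theorem deFinetti_lump_sum_below_boundary_suboptimal
    (μ σ r : ℝ) (hμ : 0 < μ) (hσ : 0 < σ) (hr : 0 < r)
    (ζ₁ ζ₂ : ℝ)
    (hζ₁ : ζ₁ = (-μ - Real.sqrt (μ ^ 2 + 2 * r * σ ^ 2)) / σ ^ 2)
    (hζ₂ : ζ₂ = (-μ + Real.sqrt (μ ^ 2 + 2 * r * σ ^ 2)) / σ ^ 2)
    (ψ : ℝ → ℝ)
    (hψ : ∀ y : ℝ, ψ y = (Real.exp (ζ₂ * y) - Real.exp (ζ₁ * y)) / (ζ₂ - ζ₁))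
    (B : ℝ) (hB : B = (Real.log (ζ₁ ^ 2) - Real.log (ζ₂ ^ 2)) / (ζ₂ - ζ₁))
    (V : ℝ → ℝ)
    (hV₁ : ∀ y : ℝ, y ≤ B → V y = ψ y / deriv ψ B)
    (hV₂ : ∀ y : ℝ, B < y → V y = y - B + V B)
    (c : ℝ → ℝ)
    (hc₁ : ∀ y : ℝ, 0 ≤ y → y ≤ B → c y = (deriv V y - 1) / deriv V y)
    (hc₂ : ∀ y : ℝ, B < y → c y = 0)
    (phat : ℝ) (hphat : phat = (deriv V 0 - 1) / deriv V 0)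
    (b : ℝ → ℝ)
    (hb₁ : ∀ q : ℝ, 0 ≤ q → q ≤ phat → b q ∈ Set.Icc 0 B ∧ c (b q) = q)
    (hb₂ : ∀ q : ℝ, phat < q → q ≤ 1 → b q = 0) :
    ∀ p ∈ Set.Ioo (0 : ℝ) phat, ∀ y : ℝ, 0 ≤ y → y ≤ b p →
      (b p - y ≤ (1 - p) * (V (b p) - V y)) ∧
      (∀ x : ℝ, b p ≤ x →
        (1 - p) * V y + (x - y) ≤ (1 - p) * V (b p) + (x - b p)) := by
  have hσ2 : 0 < σ ^ 2 := by positivity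
  have hsqrt : μ < Real.sqrt (μ ^ 2 + 2 * r * σ ^ 2) :=
    Real.lt_sqrt_of_sq_lt (lt_add_of_pos_right _ (by positivity))
  have hneg : ζ₁ < 0 := hζ₁ ▸ div_neg_of_neg_of_pos (by linarith) hσ2
  have hpos : 0 < ζ₂ := hζ₂ ▸ div_pos (by linarith) hσ2
  have hψ_eq : ψ = fun s => (Real.exp (ζ₂ * s) - Real.exp (ζ₁ * s)) / (ζ₂ - ζ₁) := funext hψ
  have hψ_deriv (s : ℝ) : HasDerivAt ψ (deriv ψ s) s := by
    rw [hψ_eq]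
    exact (hasDerivAt_expDiff ζ₁ ζ₂ s).differentiableAt.hasDerivAt
  have hψ_pos (s : ℝ) : 0 < deriv ψ s := by
    rw [hψ_eq, (hasDerivAt_expDiff ζ₁ ζ₂ s).deriv]
    have h₁ := mul_pos hpos (Real.exp_pos (ζ₂ * s))
    have h₂ := mul_neg_of_neg_of_pos hneg (Real.exp_pos (ζ₁ * s))
    exact div_pos (by linarith) (by linarith)
  have hconc : ConcaveOn ℝ (Set.Iic B) ψ := by
    rw [hψ_eq, hB]
    exact concaveOn_expDiff hneg hpos
  intro p ⟨hp, hp'⟩ y hy hyb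
  obtain ⟨⟨hb0, hbB⟩, hcb⟩ := hb₁ p hp.le hp'.le
  rw [hc₁ _ hb0 hbB] at hcb
  have hV_ne : deriv V (b p) ≠ 0 := fun h => by
    rw [h, div_zero] at hcb
    exact hp.ne hcb
  have hV_deriv : deriv V (b p) = deriv ψ (b p) / deriv ψ B := by
    have h₁ := (differentiableAt_of_deriv_ne_zero hV_ne).hasDerivAt.hasDerivWithinAt
      (s := Set.Iic B)
    have h₂ := (((hψ_deriv (b p)).div_const (deriv ψ B)).hasDerivWithinAt
      (s := Set.Iic B)).congr (fun z hz => hV₁ z hz) (hV₁ _ hbB)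
    exact (uniqueDiffOn_Iic B _ hbB).eq_deriv _ h₁ h₂
  have hp_eq : (1 - p) * (deriv ψ (b p) / deriv ψ B) = 1 := by
    rw [div_eq_iff hV_ne] at hcb
    rw [← hV_deriv]
    linarith
  have hp1 : 0 < 1 - p := pos_of_mul_pos_left (hp_eq ▸ one_pos)
    (div_pos (hψ_pos _) (hψ_pos _)).le
  have htangent : deriv ψ (b p) * (b p - y) ≤ ψ (b p) - ψ y := by
    rcases hyb.eq_or_lt with rfl | hlt
    · simp
    · have h := hconc.le_slope_of_hasDerivAt (hyb.trans hbB) hbB hlt (hψ_deriv _)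
      rwa [slope_def_field, le_div_iff₀ (sub_pos.2 hlt)] at h
  have hmain : b p - y ≤ (1 - p) * (V (b p) - V y) := by
    rw [hV₁ _ hbB, hV₁ _ (hyb.trans hbB), ← sub_div]
    calc b p - y = (1 - p) * (deriv ψ (b p) * (b p - y) / deriv ψ B) := by
          rw [mul_div_right_comm, ← mul_assoc, hp_eq, one_mul]
      _ ≤ _ := by
          have := hψ_pos B
          gcongr
  exact ⟨hmain, fun x _ => by linarith⟩
end
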